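/- arXiv:0912.4748 — 3 statements merged into one kernel-verified Lean document; each statement's English description precedes it below -/
import Mathlib

section
/- (Z_p-Tucker lemma) Let p be prime, n, m ≥ 1, α ≤ m, and let λ : (Z_p ∪ {0})^n \ {0} → Z_p × [m], λ(X) = (λ_1(X), λ_2(X)), be a Z_p-equivariant map (i.e., λ_1(ω·X) = ω·λ_1(X) and λ_2(ω·X) = λ_2(X) for the coordinatewise action of Z_p) such that: (i) for all X ⊆ Y with λ_2(X) = λ_2(Y) ≤ α, we have λ_1(X) = λ_1(Y); (ii) for all chains X^(1) ⊆ X^(2) ⊆ ... ⊆ X^(p) with λ_2(X^(1)) = ... = λ_2(X^(p)) ≥ α+1, the values λ_1(X^(i)), i = 1,...,p, are not pairwise distinct. Then α + (m-α)(p-1) ≥ n. -/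
namespace ZpTucker

/-! ### Cochains on lists -/

section Cochains

variable {V W R : Type*} [CommRing R]

/-- The augmented simplicial coboundary on functions of finite sequences of vertices. -/
def cobdry : (List V → R) → List V → R
  | _, [] => 0
  | c, x :: l => c l - cobdry (fun t => c (x :: t)) l

@[simp] lemma cobdry_nil (c : List V → R) : cobdry c [] = 0 := by
  rw [cobdry]

lemma cobdry_cons (c : List V → R) (x : V) (l : List V) :
    cobdry c (x :: l) = c l - cobdry (fun t => c (x :: t)) l := by
  rw [cobdry]

lemma cobdry_sub (c c' : List V → R) (l : List V) :
    cobdry (fun t => c t - c' t) l = cobdry c l - cobdry c' l := by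
  induction l generalizing c c' with
  | nil => simp
  | cons x l ih => simp only [cobdry_cons, ih]; ring

lemma cobdry_zero (l : List V) : cobdry (fun _ => (0 : R)) l = 0 := by
  induction l with
  | nil => simp
  | cons x l ih => simp only [cobdry_cons, ih]; ring

lemma cobdry_neg (c : List V → R) (l : List V) :
    cobdry (fun t => -c t) l = -cobdry c l := by
  simpa [cobdry_zero] using cobdry_sub (fun _ => 0) c l

lemma cobdry_sum {ι : Type*} (s : Finset ι) (c : ι → List V → R) (l : List V) :
    cobdry (fun t => ∑ i ∈ s, c i t) l = ∑ i ∈ s, cobdry (c i) l := by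
  induction l generalizing c with
  | nil => simp
  | cons x l ih => simp only [cobdry_cons, ih, Finset.sum_sub_distrib]

lemma cobdry_map (c : List W → R) (f : V → W) (l : List V) :
    cobdry (fun t => c (t.map f)) l = cobdry c (l.map f) := by
  induction l generalizing c with
  | nil => simp
  | cons x l ih =>
    simp only [List.map_cons, cobdry_cons, ← ih]

lemma cobdry_cobdry (c : List V → R) (l : List V) : cobdry (cobdry c) l = 0 := by
  induction l generalizing c with
  | nil => simp
  | cons x l ih => simp only [cobdry_cons, cobdry_sub, ih]; ring

lemma cobdry_congr {c c' : List V → R} {l : List V}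
    (h : ∀ t, t.Sublist l → c t = c' t) : cobdry c l = cobdry c' l := by
  induction l generalizing c c' with
  | nil => simp
  | cons x l ih =>
    rw [cobdry_cons, cobdry_cons, h l (List.sublist_cons_self x l),
      ih fun t ht => h _ (ht.cons_cons x)]

/-- The prism operator attached to a map `g` of vertices. -/
def prism (g : V → V) : (List V → R) → List V → R
  | _, [] => 0
  | c, x :: l => c (x :: g x :: l.map g) - prism g (fun t => c (x :: t)) l

lemma prism_nil (g : V → V) (c : List V → R) : prism g c [] = 0 := by
  rw [prism]

lemma prism_cons (g : V → V) (c : List V → R) (x : V) (l : List V) :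
    prism g c (x :: l) =
      c (x :: g x :: l.map g) - prism g (fun t => c (x :: t)) l := by
  rw [prism]

lemma prism_sub (g : V → V) (c c' : List V → R) (l : List V) :
    prism g (fun t => c t - c' t) l = prism g c l - prism g c' l := by
  induction l generalizing c c' with
  | nil => simp [prism_nil]
  | cons x l ih => simp only [prism_cons, ih]; ring

lemma prism_homotopy (g : V → V) (c : List V → R) (l : List V) :
    cobdry (prism g c) l + prism g (cobdry c) l = c (l.map g) - c l := by
  induction l generalizing c with
  | nil => simp [prism_nil]
  | cons x l ih =>
    have h1 := ih fun t => c (x :: t)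
    have h2 := cobdry_map (fun t => c (x :: g x :: t)) g l
    simp only [cobdry_cons, prism_cons, cobdry_sub, prism_sub, List.map_cons] at h1 h2 ⊢
    linear_combination h1 - h2

lemma prism_eq_zero (g : V → V) {c : List V → R} {l : List V}
    (h : ∀ l₁ x l₂, l = l₁ ++ x :: l₂ → c (l₁ ++ x :: g x :: l₂.map g) = 0) :
    prism g c l = 0 := by
  induction l generalizing c with
  | nil => simp [prism_nil]
  | cons x l ih =>
    rw [prism_cons, ih (c := fun t => c (x :: t)) fun l₁ y l₂ hl => by
      simpa using h (x :: l₁) y l₂ (by simp [hl])]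
    simpa using h [] x l rfl

/-- The prism to the image of `g`, followed by the cone with apex `e`. -/
def contraction (g : V → V) (e : V) (c : List V → R) : List V → R :=
  fun l => c (e :: l.map g) - prism g c l

lemma contraction_homotopy (g : V → V) (e : V) (c : List V → R) (l : List V) :
    cobdry (contraction g e c) l + contraction g e (cobdry c) l = c l := by
  have h1 := prism_homotopy g c l
  have h2 := cobdry_map (fun t => c (e :: t)) g l
  unfold contraction
  simp only [cobdry_cons, cobdry_sub] at h1 h2 ⊢
  linear_combination h2 - h1

/-- Alternating cochains. -/
structure Alt (c : List V → R) : Prop where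
  swap : ∀ l₁ x y l₂, c (l₁ ++ x :: y :: l₂) = -c (l₁ ++ y :: x :: l₂)
  dup : ∀ l₁ x l₂, c (l₁ ++ x :: x :: l₂) = 0

lemma Alt.cons {c : List V → R} (h : Alt c) (x : V) : Alt fun t => c (x :: t) where
  swap l₁ y z l₂ := h.swap (x :: l₁) y z l₂
  dup l₁ y l₂ := h.dup (x :: l₁) y l₂

lemma Alt.map {c : List W → R} (h : Alt c) (f : V → W) : Alt fun t => c (t.map f) where
  swap l₁ y z l₂ := by simpa using h.swap (l₁.map f) (f y) (f z) (l₂.map f)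
  dup l₁ y l₂ := by simpa using h.dup (l₁.map f) (f y) (l₂.map f)

lemma Alt.cobdry {c : List V → R} (h : Alt c) : Alt (cobdry c) where
  swap l₁ x y l₂ := by
    induction l₁ generalizing c with
    | nil =>
      have h1 : (fun t => c (x :: y :: t)) = fun t => -c (y :: x :: t) :=
        funext fun t => h.swap [] x y t
      simp only [List.nil_append, cobdry_cons, h1, cobdry_neg]
      ring
    | cons z l₁ ih =>
      simp only [List.cons_append, cobdry_cons, ih (h.cons z), h.swap l₁ x y l₂]
      ring
  dup l₁ x l₂ := by
    induction l₁ generalizing c with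
    | nil =>
      have h1 : (fun t => c (x :: x :: t)) = fun t => 0 :=
        funext fun t => h.dup [] x t
      simp only [List.nil_append, cobdry_cons, h1, cobdry_zero]
      ring
    | cons z l₁ ih =>
      simp only [List.cons_append, cobdry_cons, ih (h.cons z), h.dup l₁ x l₂]
      ring

lemma Alt.eq_zero_of_perm {c : List V → R} (h : Alt c) {l l' : List V} (hl : l.Perm l')
    (h0 : c l = 0) : c l' = 0 := by
  induction hl generalizing c with
  | nil => exact h0
  | cons x _ ih => exact ih (h.cons x) h0
  | swap x y l =>
    have := h.swap [] x y l
    simp_all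
  | trans _ _ ih1 ih2 => exact ih2 h (ih1 h h0)

lemma Alt.eq_zero_of_not_nodup {c : List V → R} (h : Alt c) {l : List V} (hl : ¬ l.Nodup) :
    c l = 0 := by
  classical
  obtain ⟨x, hx⟩ : ∃ x, [x, x].Sublist l := by
    simpa [List.nodup_iff_sublist] using hl
  obtain ⟨t, ht⟩ := hx.exists_perm_append
  exact h.eq_zero_of_perm ht.symm (h.dup [] x t)

end Cochains

/-! ### The norm and difference operators -/

section Operators

variable {p : ℕ} [Fact p.Prime] {V : Type*}

/-- For even `r` the norm operator, for odd `r` the difference operator, of an action of `ZMod p`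
on vertices, acting on cochains. -/
def normDiff (f : ZMod p → V → V) (r : ℕ) (c : List V → ZMod p) : List V → ZMod p :=
  fun l => if Even r then ∑ g, c (l.map (f g)) else c (l.map (f 1)) - c l

lemma normDiff_nil (f : ZMod p → V → V) (r : ℕ) (c : List V → ZMod p) :
    normDiff f r c [] = 0 := by
  simp [normDiff]

lemma cobdry_normDiff (f : ZMod p → V → V) (r : ℕ) (c : List V → ZMod p) (l : List V) :
    cobdry (normDiff f r c) l = normDiff f r (cobdry c) l := by
  unfold normDiff
  by_cases hr : Even r
  · simp only [hr, if_true, cobdry_sum, cobdry_map]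
  · simp only [hr, if_false, cobdry_sub, cobdry_map]

lemma normDiff_congr (f : ZMod p → V → V) (r : ℕ) {c c' : List V → ZMod p} {l : List V}
    (h0 : c l = c' l) (h : ∀ g, c (l.map (f g)) = c' (l.map (f g))) :
    normDiff f r c l = normDiff f r c' l := by
  simp only [normDiff, h0, h]

lemma normDiff_add (f : ZMod p → V → V) (r : ℕ) (c c' : List V → ZMod p) (l : List V) :
    normDiff f r (fun t => c t + c' t) l = normDiff f r c l + normDiff f r c' l := by
  by_cases hr : Even r
  · simp only [normDiff, hr, if_true, Finset.sum_add_distrib]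
  · simp only [normDiff, hr, if_false]; ring

lemma map_map_action {f : ZMod p → V → V} (hf : ∀ g h x, f g (f h x) = f (g + h) x)
    (g h : ZMod p) (l : List V) : (l.map (f h)).map (f g) = l.map (f (g + h)) := by
  simp [hf, Function.comp_def]

lemma normDiff_comp {f : ZMod p → V → V} (hf : ∀ g h x, f g (f h x) = f (g + h) x)
    (r : ℕ) (c : List V → ZMod p) (l : List V) :
    normDiff f r (normDiff f (r + 1) c) l = 0 := by
  by_cases hr : Even r
  · have hr' : ¬ Even (r + 1) := by simpa [Nat.even_add_one] using hr
    simp only [normDiff, hr, hr', if_true, if_false, map_map_action hf, Finset.sum_sub_distrib]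
    rw [sub_eq_zero]
    exact Equiv.sum_comp (Equiv.addLeft (1 : ZMod p)) fun g => c (l.map (f g))
  · have hr' : Even (r + 1) := by simpa [Nat.even_add_one] using hr
    simp only [normDiff, hr, hr', if_true, if_false, map_map_action hf]
    rw [sub_eq_zero]
    exact Equiv.sum_comp (Equiv.addRight (1 : ZMod p)) fun g => c (l.map (f g))

end Operators

/-! ### The target complex -/

section Target

variable {p : ℕ}

/-- Translation of the sign in a signed label. -/
def shift (g : ZMod p) (t : ZMod p × ℕ) : ZMod p × ℕ := (g + t.1, t.2)

lemma shift_shift (g h : ZMod p) (t : ZMod p × ℕ) : shift g (shift h t) = shift (g + h) t := by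
  simp [shift, add_assoc]

lemma shift_zero : shift (0 : ZMod p) = id := by
  funext t; simp [shift]

lemma mem_map_shift {g : ZMod p} {l : List (ZMod p × ℕ)} {t : ZMod p × ℕ} :
    t ∈ l.map (shift g) ↔ (t.1 - g, t.2) ∈ l := by
  constructor
  · intro h
    obtain ⟨u, hu, rfl⟩ := List.mem_map.1 h
    simpa [shift] using hu
  · intro h
    exact List.mem_map.2 ⟨_, h, by simp [shift]⟩

/-- Vertex sequences of simplices of the join of `α` copies of `Z_p` and `m - α` copies of the
boundary of the simplex on `Z_p`. -/
structure IsSimplex (α m : ℕ) (l : List (ZMod p × ℕ)) : Prop where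
  label_mem : ∀ t ∈ l, t.2 ∈ Finset.Icc 1 m
  sign_eq : ∀ t ∈ l, ∀ u ∈ l, t.2 = u.2 → t.2 ≤ α → t.1 = u.1
  exists_notMem : ∀ j, α < j → ∃ g, (g, j) ∉ l

lemma IsSimplex.of_subset {α m : ℕ} {l l' : List (ZMod p × ℕ)} (h : IsSimplex α m l)
    (hl : l' ⊆ l) : IsSimplex α m l' where
  label_mem t ht := h.label_mem t (hl ht)
  sign_eq t ht u hu := h.sign_eq t (hl ht) u (hl hu)
  exists_notMem j hj := (h.exists_notMem j hj).imp fun _ hg hg' => hg (hl hg')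

variable [Fact p.Prime]

lemma IsSimplex.map_shift {α m : ℕ} {l : List (ZMod p × ℕ)} (h : IsSimplex α m l)
    (g : ZMod p) : IsSimplex α m (l.map (shift g)) where
  label_mem t ht := h.label_mem (t.1 - g, t.2) (mem_map_shift.1 ht)
  sign_eq t ht u hu h1 h2 := by
    simpa using h.sign_eq _ (mem_map_shift.1 ht) _ (mem_map_shift.1 hu) h1 h2
  exists_notMem j hj := by
    obtain ⟨k, hk⟩ := h.exists_notMem j hj
    exact ⟨k + g, by simpa [mem_map_shift] using hk⟩

/-- The signs with which the label `j` occurs. -/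
def signs (l : List (ZMod p × ℕ)) (j : ℕ) : Finset (ZMod p) := {g | (g, j) ∈ l}

/-- The least label that occurs. -/
noncomputable def minLabel (l : List (ZMod p × ℕ)) : ℕ := sInf {j | ∃ g, (g, j) ∈ l}

/-- The average of the signs with which the least label occurs. -/
noncomputable def meanSign (l : List (ZMod p × ℕ)) : ZMod p :=
  (∑ g ∈ signs l (minLabel l), g) / (signs l (minLabel l)).card

lemma meanSign_congr {l l' : List (ZMod p × ℕ)} (h : ∀ t, t ∈ l ↔ t ∈ l') :
    meanSign l = meanSign l' := by
  have h1 : minLabel l = minLabel l' := by simp [minLabel, h]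
  have h2 : signs l (minLabel l') = signs l' (minLabel l') := by ext g; simp [signs, h]
  rw [meanSign, meanSign, h1, h2]

lemma minLabel_map_shift (g : ZMod p) (l : List (ZMod p × ℕ)) :
    minLabel (l.map (shift g)) = minLabel l := by
  unfold minLabel
  congr 1
  ext j
  simp only [mem_map_shift, Set.mem_ofPred_eq]
  exact ⟨fun ⟨k, hk⟩ => ⟨_, hk⟩, fun ⟨k, hk⟩ => ⟨k + g, by simpa using hk⟩⟩

lemma signs_map_shift (g : ZMod p) (l : List (ZMod p × ℕ)) (j : ℕ) :
    signs (l.map (shift g)) j = (signs l j).map (Equiv.addLeft g).toEmbedding := by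
  ext k
  simp only [signs, mem_map_shift, Finset.mem_filter, Finset.mem_univ, true_and,
    Finset.mem_map_equiv]
  simp [sub_eq_neg_add]

lemma signs_minLabel_nonempty {l : List (ZMod p × ℕ)} (hl : l ≠ []) :
    (signs l (minLabel l)).Nonempty := by
  obtain ⟨t, ht⟩ := List.exists_mem_of_ne_nil l hl
  obtain ⟨g, hg⟩ := Nat.sInf_mem (s := {j | ∃ g, (g, j) ∈ l}) ⟨t.2, t.1, ht⟩
  exact ⟨g, Finset.mem_filter.2 ⟨Finset.mem_univ g, hg⟩⟩

lemma IsSimplex.card_signs_le {α m : ℕ} {l : List (ZMod p × ℕ)} (h : IsSimplex α m l) (j : ℕ) :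
    (signs l j).card ≤ if j ≤ α then 1 else p - 1 := by
  split_ifs with hj
  · refine Finset.card_le_one.2 fun a ha b hb => ?_
    simp only [signs, Finset.mem_filter, Finset.mem_univ, true_and] at ha hb
    exact h.sign_eq _ ha _ hb rfl hj
  · obtain ⟨k, hk⟩ := h.exists_notMem j (not_le.1 hj)
    have : (signs l j).card < Fintype.card (ZMod p) :=
      Finset.card_lt_univ_of_notMem (x := k) (by simpa [signs] using hk)
    rw [ZMod.card] at this
    omega

lemma IsSimplex.meanSign_map_shift {α m : ℕ} {l : List (ZMod p × ℕ)} (h : IsSimplex α m l)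
    (hl : l ≠ []) (g : ZMod p) : meanSign (l.map (shift g)) = g + meanSign l := by
  have hp : p.Prime := Fact.out
  have hcard : ((signs l (minLabel l)).card : ZMod p) ≠ 0 := by
    rw [Ne, ZMod.natCast_eq_zero_iff]
    have h1 := (signs_minLabel_nonempty hl).card_pos
    have h2 := h.card_signs_le (minLabel l)
    have h3 := hp.two_le
    refine Nat.not_dvd_of_pos_of_lt h1 ?_
    split_ifs at h2 <;> omega
  simp only [meanSign, minLabel_map_shift, signs_map_shift, Finset.sum_map, Finset.card_map]
  simp only [Equiv.coe_toEmbedding, Equiv.coe_addLeft]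
  rw [Finset.sum_add_distrib, Finset.sum_const, nsmul_eq_mul]
  field_simp

lemma IsSimplex.not_nodup {α m : ℕ} (hα : α ≤ m) {l : List (ZMod p × ℕ)} (h : IsSimplex α m l)
    (hl : α + (m - α) * (p - 1) < l.length) : ¬ l.Nodup := by
  intro hnd
  rw [← List.toFinset_card_of_nodup hnd,
    Finset.card_eq_sum_card_fiberwise (f := Prod.snd) (t := Finset.Icc 1 m)
      fun t ht => h.label_mem t (by simpa using ht)] at hl
  refine absurd hl (not_lt.2 ?_)
  calc ∑ j ∈ Finset.Icc 1 m, (l.toFinset.filter fun t => t.2 = j).card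
      ≤ ∑ j ∈ Finset.Icc 1 m, if j ≤ α then 1 else p - 1 := by
        refine Finset.sum_le_sum fun j _ => le_trans ?_ (h.card_signs_le j)
        refine Finset.card_le_card_of_injOn Prod.fst ?_ ?_
        · rintro ⟨g, k⟩ ht
          simp only [Finset.coe_filter, List.mem_toFinset, Set.mem_ofPred_eq] at ht
          obtain ⟨ht, rfl⟩ := ht
          simpa [signs] using ht
        · rintro ⟨g, k⟩ ht ⟨g', k'⟩ ht' hgg
          simp only [Finset.coe_filter, List.mem_toFinset, Set.mem_ofPred_eq] at ht ht'
          exact Prod.ext hgg (ht.2.trans ht'.2.symm)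
    _ = α + (m - α) * (p - 1) := by
        rw [Finset.sum_ite, Finset.sum_const, Finset.sum_const]
        have h1 : (Finset.Icc 1 m).filter (· ≤ α) = Finset.Icc 1 α := by
          ext j; simp only [Finset.mem_filter, Finset.mem_Icc]; omega
        have h2 : (Finset.Icc 1 m).filter (fun j => ¬ j ≤ α) = Finset.Ioc α m := by
          ext j; simp only [Finset.mem_filter, Finset.mem_Icc, Finset.mem_Ioc]; omega
        rw [h1, h2]
        simp

lemma exists_norm_eq {α m : ℕ} {b : List (ZMod p × ℕ) → ZMod p} (hb : Alt b)
    (hinv : ∀ l, IsSimplex α m l → b (l.map (shift 1)) = b l) :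
    ∃ a : List (ZMod p × ℕ) → ZMod p, Alt a ∧
      ∀ l, IsSimplex α m l → l ≠ [] → ∑ g, a (l.map (shift g)) = b l := by
  have hinv' : ∀ (k : ℕ) l, IsSimplex α m l → b (l.map (shift (k : ZMod p))) = b l := by
    intro k
    induction k with
    | zero => intro l _; simp [shift_zero]
    | succ k ih =>
      intro l hl
      rw [Nat.cast_succ, ← map_map_action shift_shift, ih _ (hl.map_shift 1), hinv l hl]
  refine ⟨fun l => if meanSign l = 0 then b l else 0, ⟨fun l₁ x y l₂ => ?_, fun l₁ x l₂ => ?_⟩,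
    fun l hl hne => ?_⟩
  · rw [hb.swap, meanSign_congr (l' := l₁ ++ y :: x :: l₂) (by intro t; simp; tauto)]
    split_ifs <;> simp
  · simp [hb.dup]
  · beta_reduce
    rw [Finset.sum_eq_single (-meanSign l)]
    · rw [hl.meanSign_map_shift hne, neg_add_cancel, if_pos rfl]
      simpa using hinv' (-meanSign l).val l hl
    · intro g _ hg
      rw [hl.meanSign_map_shift hne, if_neg fun h => hg (eq_neg_of_add_eq_zero_left h)]
    · simp

lemma exists_diff_eq {α m : ℕ} {b : List (ZMod p × ℕ) → ZMod p} (hb : Alt b)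
    (hnorm : ∀ l, IsSimplex α m l → ∑ g, b (l.map (shift g)) = 0) :
    ∃ a : List (ZMod p × ℕ) → ZMod p, Alt a ∧
      ∀ l, IsSimplex α m l → l ≠ [] → a (l.map (shift 1)) - a l = b l := by
  have hp : p.Prime := Fact.out
  refine ⟨fun l => ∑ i ∈ Finset.range (meanSign l).val,
    b (l.map (shift ((i : ZMod p) - meanSign l))),
    ⟨fun l₁ x y l₂ => ?_, fun l₁ x l₂ => ?_⟩, fun l hl hne => ?_⟩
  · rw [meanSign_congr (l' := l₁ ++ y :: x :: l₂) (by intro t; simp; tauto),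
      ← Finset.sum_neg_distrib]
    exact Finset.sum_congr rfl fun i _ => (hb.map _).swap l₁ x y l₂
  · exact Finset.sum_eq_zero fun i _ => (hb.map _).dup l₁ x l₂
  · have hs := hl.meanSign_map_shift hne 1
    have key : ∑ i ∈ Finset.range ((meanSign l).val + 1),
        b (l.map (shift ((i : ZMod p) - meanSign l))) =
        (∑ i ∈ Finset.range (meanSign l).val,
          b (l.map (shift ((i : ZMod p) - meanSign l)))) + b l := by
      rw [Finset.sum_range_succ]
      simp [shift_zero]
    have harg : ∀ i : ZMod p, i - (1 + meanSign l) + 1 = i - meanSign l := fun i => by ring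
    simp only [hs, map_map_action shift_shift, harg]
    rw [sub_eq_iff_eq_add', ← key]
    by_cases hlt : (meanSign l).val + 1 < p
    · have : Fact (1 < p) := ⟨hp.one_lt⟩
      rw [add_comm, ZMod.val_add_of_lt (by rwa [ZMod.val_one]), ZMod.val_one]
    · have hval : (meanSign l).val + 1 = p := by
        have := ZMod.val_lt (meanSign l); omega
      have hz : 1 + meanSign l = 0 := by
        rw [add_comm, ← ZMod.natCast_zmod_val (meanSign l), ← Nat.cast_succ]
        simp [hval]
      rw [hz, hval, ZMod.val_zero, Finset.sum_range_zero, eq_comm]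
      rw [← hnorm l hl, ← Equiv.sum_comp (Equiv.subRight (meanSign l))]
      refine Finset.sum_nbij (fun i => (i : ZMod p)) (by simp) ?_ ?_ (by simp)
      · intro i hi j hj hij
        simp only [Finset.coe_range, Set.mem_Iio] at hi hj
        have := congrArg ZMod.val hij
        simpa [ZMod.val_cast_of_lt hi, ZMod.val_cast_of_lt hj] using this
      · intro g _
        exact ⟨g.val, by simpa using ZMod.val_lt g, by simp⟩

lemma exists_normDiff_eq {α m r : ℕ} {b : List (ZMod p × ℕ) → ZMod p} (hb : Alt b)
    (h0 : b [] = 0) (hcomp : ∀ l, IsSimplex α m l → normDiff shift (r + 1) b l = 0) :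
    ∃ a : List (ZMod p × ℕ) → ZMod p, Alt a ∧
      ∀ l, IsSimplex α m l → b l = normDiff shift r a l := by
  suffices H : ∃ a : List (ZMod p × ℕ) → ZMod p, Alt a ∧
      ∀ l, IsSimplex α m l → l ≠ [] → normDiff shift r a l = b l by
    obtain ⟨a, ha, h⟩ := H
    refine ⟨a, ha, fun l hl => ?_⟩
    rcases eq_or_ne l [] with rfl | hne
    · rw [h0, normDiff_nil]
    · exact (h l hl hne).symm
  by_cases hr : Even r
  · have hr' : ¬ Even (r + 1) := by simpa [Nat.even_add_one] using hr
    simp only [normDiff, hr, hr', if_true, if_false, sub_eq_zero] at hcomp ⊢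
    exact exists_norm_eq hb hcomp
  · have hr' : Even (r + 1) := by simpa [Nat.even_add_one] using hr
    simp only [normDiff, hr, hr', if_true, if_false] at hcomp ⊢
    exact exists_diff_eq hb hcomp

/-- A cochain-level classifying sequence for the free action on the target complex. -/
lemma exists_cochain_sequence (p : ℕ) [Fact p.Prime] (α m : ℕ) :
    ∃ a : ℕ → List (ZMod p × ℕ) → ZMod p, (∀ r, Alt (a r)) ∧ a 0 [] = 1 ∧
      ∀ r l, IsSimplex α m l → cobdry (a r) l = normDiff shift r (a (r + 1)) l := by
  let Q (r : ℕ) (c : List (ZMod p × ℕ) → ZMod p) : Prop :=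
    Alt c ∧ ∀ l, IsSimplex α m l → normDiff shift (r + 1) (cobdry c) l = 0
  have step : ∀ r (c : {c // Q r c}), ∃ c' : {c // Q (r + 1) c},
      ∀ l, IsSimplex α m l → cobdry c.1 l = normDiff shift r c'.1 l := by
    rintro r ⟨c, hc, hc'⟩
    obtain ⟨a, ha, h⟩ := exists_normDiff_eq hc.cobdry (cobdry_nil c) hc'
    refine ⟨⟨a, ha, fun l hl => ?_⟩, h⟩
    have hpar : normDiff (shift (p := p)) (r + 1 + 1) = normDiff shift r := by
      simp [funext_iff, normDiff, Nat.even_add_one]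
    rw [hpar, ← cobdry_normDiff, ← cobdry_cobdry c l]
    exact cobdry_congr fun t ht => (h t (hl.of_subset ht.subset)).symm
  let c₀ : List (ZMod p × ℕ) → ZMod p := fun l => if l = [] then 1 else 0
  have h₀ : Q 0 c₀ := by
    refine ⟨⟨fun l₁ x y l₂ => by simp [c₀], fun l₁ x l₂ => by simp [c₀]⟩, fun l _ => ?_⟩
    rw [← cobdry_normDiff, ← cobdry_zero (R := ZMod p) l]
    congr 1
    funext t
    simp [normDiff, c₀]
  choose next hnext using step
  let seq (r : ℕ) : {c // Q r c} := Nat.rec ⟨c₀, h₀⟩ next r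
  exact ⟨fun r => (seq r).1, fun r => (seq r).2.1, by simp [seq, c₀],
    fun r l hl => hnext r (seq r) l hl⟩

end Target

/-! ### Flags of sign vectors -/

section Source

variable {p n : ℕ}

/-- The coordinatewise action on sign vectors. -/
def act (g : ZMod p) (X : Fin n → Option (ZMod p)) : Fin n → Option (ZMod p) :=
  fun i => (X i).map (g + ·)

lemma act_act (g h : ZMod p) (X : Fin n → Option (ZMod p)) :
    act g (act h X) = act (g + h) X := by
  funext i
  simp [act, Option.map_map, Function.comp_def, add_assoc]

/-- The extension order on sign vectors. -/
def Ext (X Y : Fin n → Option (ZMod p)) : Prop := ∀ i, X i ≠ none → Y i = X i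

/-- Flags of `r` nonzero sign vectors supported on the first `r` coordinates. -/
structure IsFlag (r : ℕ) (l : List (Fin n → Option (ZMod p))) : Prop where
  length_eq : l.length = r
  ne_zero : ∀ X ∈ l, ∃ i, X i ≠ none
  supp : ∀ X ∈ l, ∀ i : Fin n, r ≤ i.val → X i = none
  pairwise : l.Pairwise Ext

lemma IsFlag.map_act {r : ℕ} {l : List (Fin n → Option (ZMod p))} (h : IsFlag r l)
    (g : ZMod p) : IsFlag r (l.map (act g)) where
  length_eq := by simpa using h.length_eq
  ne_zero := by
    intro X hX
    obtain ⟨Y, hY, rfl⟩ := List.mem_map.1 hX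
    simpa [act] using h.ne_zero Y hY
  supp := by
    intro X hX i hi
    obtain ⟨Y, hY, rfl⟩ := List.mem_map.1 hX
    simpa [act] using h.supp Y hY i hi
  pairwise := by
    refine List.pairwise_map.2 (h.pairwise.imp fun {X Y} hXY i hi => ?_)
    simp only [act] at hi ⊢
    rw [hXY i (by simpa using hi)]

/-- Setting the `k`-th coordinate to the sign `0`. -/
def fill (k : Fin n) (X : Fin n → Option (ZMod p)) : Fin n → Option (ZMod p) :=
  Function.update X k (some 0)

lemma fill_ne_zero (k : Fin n) (X : Fin n → Option (ZMod p)) : ∃ i, fill k X i ≠ none :=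
  ⟨k, by simp [fill]⟩

lemma fill_supp (k : Fin n) {X : Fin n → Option (ZMod p)}
    (hX : ∀ i : Fin n, k.val ≤ i.val → X i = none) (i : Fin n) (hi : k.val + 1 ≤ i.val) :
    fill k X i = none := by
  have : i ≠ k := by rintro rfl; omega
  simp [fill, this, hX i (by omega)]

lemma Ext.fill_right {k : Fin n} {X Y : Fin n → Option (ZMod p)} (h : Ext X Y)
    (hX : X k = none) : Ext X (fill k Y) := by
  intro i hi
  have : i ≠ k := by rintro rfl; exact hi hX
  simpa [fill, this] using h i hi

lemma Ext.fill_fill {X Y : Fin n → Option (ZMod p)} (h : Ext X Y) (k : Fin n) :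
    Ext (fill k X) (fill k Y) := by
  intro i hi
  by_cases hik : i = k
  · simp [fill, hik]
  · simpa [fill, hik] using h i (by simpa [fill, hik] using hi)

lemma Ext.refl (X : Fin n → Option (ZMod p)) : Ext X X := fun _ _ => rfl

lemma IsFlag.cone {k : Fin n} {l : List (Fin n → Option (ZMod p))} (h : IsFlag k.val l) :
    IsFlag (k.val + 1) (fill k (fun _ => none) :: l.map (fill k)) where
  length_eq := by simp [h.length_eq]
  ne_zero := by
    intro X hX
    rcases List.mem_cons.1 hX with rfl | hX
    · exact fill_ne_zero k _
    · obtain ⟨Y, _, rfl⟩ := List.mem_map.1 hX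
      exact fill_ne_zero k Y
  supp := by
    intro X hX
    rcases List.mem_cons.1 hX with rfl | hX
    · exact fill_supp k fun _ _ => rfl
    · obtain ⟨Y, hY, rfl⟩ := List.mem_map.1 hX
      exact fill_supp k (h.supp Y hY)
  pairwise := by
    refine List.pairwise_cons.2 ⟨fun X hX => ?_,
      List.pairwise_map.2 (h.pairwise.imp fun hXY => hXY.fill_fill k)⟩
    obtain ⟨Y, _, rfl⟩ := List.mem_map.1 hX
    exact Ext.fill_fill (fun i hi => absurd rfl hi) k

lemma IsFlag.prism {k : Fin n} {l₁ l₂ : List (Fin n → Option (ZMod p))}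
    {X : Fin n → Option (ZMod p)} (h : IsFlag k.val (l₁ ++ X :: l₂)) :
    IsFlag (k.val + 1) (l₁ ++ X :: fill k X :: l₂.map (fill k)) := by
  have hmem : ∀ Y ∈ l₁ ++ X :: fill k X :: l₂.map (fill k),
      Y ∈ l₁ ++ X :: l₂ ∨ ∃ Z ∈ l₁ ++ X :: l₂, fill k Z = Y := by
    intro Y hY
    simp only [List.mem_append, List.mem_cons, List.mem_map] at hY ⊢
    rcases hY with hY | hY | rfl | ⟨Z, hZ, rfl⟩
    · exact Or.inl (Or.inl hY)
    · exact Or.inl (Or.inr (Or.inl hY))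
    · exact Or.inr ⟨X, by simp, rfl⟩
    · exact Or.inr ⟨Z, by simp [hZ], rfl⟩
  refine ⟨?_, fun Y hY => ?_, fun Y hY => ?_, ?_⟩
  · have := h.length_eq
    simp only [List.length_append, List.length_cons, List.length_map] at this ⊢
    omega
  · rcases hmem Y hY with hY | ⟨Z, _, rfl⟩
    · exact h.ne_zero Y hY
    · exact fill_ne_zero k Z
  · rcases hmem Y hY with hY | ⟨Z, hZ, rfl⟩
    · exact fun i hi => h.supp Y hY i (by omega)
    · exact fill_supp k (h.supp Z hZ)
  · have hk : ∀ Y ∈ l₁ ++ X :: l₂, Y k = none := fun Y hY => h.supp Y hY k le_rfl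
    have hpw := h.pairwise
    simp only [List.pairwise_append, List.pairwise_cons, List.pairwise_map, List.mem_cons,
      List.mem_map, List.mem_append] at hpw hk ⊢
    obtain ⟨h1, ⟨h2, h3⟩, h4⟩ := hpw
    refine ⟨h1, ⟨?_, ?_, h3.imp fun hXY => hXY.fill_fill k⟩, ?_⟩
    · rintro Y (rfl | ⟨Z, hZ, rfl⟩)
      · exact (Ext.refl X).fill_right (hk X (by simp))
      · exact (h2 Z hZ).fill_right (hk X (by simp))
    · rintro Y ⟨Z, hZ, rfl⟩
      exact (h2 Z hZ).fill_fill k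
    · rintro Y hY Z (rfl | rfl | ⟨Z, hZ, rfl⟩)
      · exact h4 Y hY _ (Or.inl rfl)
      · exact (h4 Y hY X (Or.inl rfl)).fill_right (hk Y (Or.inl hY))
      · exact (h4 Y hY Z (Or.inr hZ)).fill_right (hk Y (Or.inl hY))

lemma contraction_eq_zero {k : Fin n} {c : List (Fin n → Option (ZMod p)) → ZMod p}
    (hc : ∀ l, IsFlag (k.val + 1) l → c l = 0) {l : List (Fin n → Option (ZMod p))}
    (hl : IsFlag k.val l) : contraction (fill k) (fill k fun _ => none) c l = 0 := by
  rw [contraction, hc _ hl.cone, prism_eq_zero (fill k), sub_zero]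
  rintro l₁ X l₂ rfl
  exact hc _ hl.prism

/-- The last term of a classifying sequence of cochains does not vanish on full flags. -/
lemma exists_flag_ne_zero [Fact p.Prime] {c : ℕ → List (Fin n → Option (ZMod p)) → ZMod p}
    (h0 : c 0 [] = 1)
    (hc : ∀ r l, IsFlag (r + 1) l → cobdry (c r) l = normDiff act r (c (r + 1)) l) :
    ∃ l, IsFlag n l ∧ c n l ≠ 0 := by
  by_contra! hzero
  have key : ∀ r ≤ n, ∃ b b' : List (Fin n → Option (ZMod p)) → ZMod p,
      ∀ l, IsFlag r l → c r l = normDiff act r b l + cobdry b' l := by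
    intro r hr
    induction hr using Nat.decreasingInduction with
    | self =>
      refine ⟨fun _ => 0, fun _ => 0, fun l hl => ?_⟩
      simp [hzero l hl, cobdry_zero, normDiff]
    | of_succ r hr ih =>
      obtain ⟨b, b', hb⟩ := ih
      let e : List (Fin n → Option (ZMod p)) → ZMod p := fun t => c r t - normDiff act r b' t
      have he : ∀ l, IsFlag (r + 1) l → cobdry e l = 0 := by
        intro l hl
        rw [cobdry_sub, hc r l hl, cobdry_normDiff,
          normDiff_congr act r (c' := fun t => normDiff act (r + 1) b t + cobdry b' t)
            (hb l hl) fun g => hb _ (hl.map_act g),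
          normDiff_add, normDiff_comp act_act]
        ring
      refine ⟨b', contraction (fill ⟨r, hr⟩) (fill ⟨r, hr⟩ fun _ => none) e, fun l hl => ?_⟩
      have h1 := contraction_homotopy (fill ⟨r, hr⟩) (fill ⟨r, hr⟩ fun _ => none) e l
      rw [contraction_eq_zero (k := ⟨r, hr⟩) he hl] at h1
      linear_combination -h1
  obtain ⟨b, b', hb⟩ := key 0 (Nat.zero_le n)
  have := hb [] ⟨rfl, by simp, by simp, List.Pairwise.nil⟩
  rw [h0, normDiff_nil, cobdry_nil, add_zero] at this
  exact one_ne_zero this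

end Source

end ZpTucker

/-- The `Z_p`-Tucker lemma.  `Z_p` is modelled additively as `ZMod p`, acting
coordinatewise on `(Z_p ∪ {0})^n = (Fin n → Option (ZMod p))` by
`g • X = fun i => (X i).map (g + ·)` (fixing `0 = none`).  `[m]` is modelled as
`{1,…,m} ⊆ ℕ`, the map `λ = (l1, l2)` being defined on the nonzero vectors. -/
theorem stmt_7 (p n m α : ℕ) (hp : p.Prime) (hn : 1 ≤ n) (hm : 1 ≤ m) (hα : α ≤ m)
    (l1 : (Fin n → Option (ZMod p)) → ZMod p)
    (l2 : (Fin n → Option (ZMod p)) → ℕ)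
    (hrange : ∀ X : Fin n → Option (ZMod p), (∃ i, X i ≠ none) → 1 ≤ l2 X ∧ l2 X ≤ m)
    (hequiv1 : ∀ (g : ZMod p) (X : Fin n → Option (ZMod p)), (∃ i, X i ≠ none) →
      l1 (fun i => (X i).map (g + ·)) = g + l1 X)
    (hequiv2 : ∀ (g : ZMod p) (X : Fin n → Option (ZMod p)), (∃ i, X i ≠ none) →
      l2 (fun i => (X i).map (g + ·)) = l2 X)
    -- property (i)
    (hi : ∀ X Y : Fin n → Option (ZMod p), (∃ i, X i ≠ none) →
      (∀ i, X i ≠ none → Y i = X i) → l2 X = l2 Y → l2 X ≤ α → l1 X = l1 Y)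
    -- property (ii)
    (hii : ∀ Xs : Fin p → (Fin n → Option (ZMod p)), (∀ a, ∃ i, Xs a i ≠ none) →
      (∀ a b : Fin p, a ≤ b → ∀ i, Xs a i ≠ none → Xs b i = Xs a i) →
      (∀ a b : Fin p, l2 (Xs a) = l2 (Xs b)) → (∀ a, α + 1 ≤ l2 (Xs a)) →
      ∃ a b : Fin p, a ≠ b ∧ l1 (Xs a) = l1 (Xs b)) :
    n ≤ α + (m - α) * (p - 1) := by
  have : Fact p.Prime := ⟨hp⟩
  by_contra! hlt
  let L : (Fin n → Option (ZMod p)) → ZMod p × ℕ := fun X => (l1 X, l2 X)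
  have hsimp : ∀ r l, ZpTucker.IsFlag r l → ZpTucker.IsSimplex α m (l.map L) := by
    intro r l hl
    have hpw := List.pairwise_iff_getElem.1 hl.pairwise
    refine ⟨?_, ?_, ?_⟩
    · intro t ht
      obtain ⟨X, hX, rfl⟩ := List.mem_map.1 ht
      exact Finset.mem_Icc.2 (hrange X (hl.ne_zero X hX))
    · intro t ht u hu h1 h2
      obtain ⟨X, hX, rfl⟩ := List.mem_map.1 ht
      obtain ⟨Y, hY, rfl⟩ := List.mem_map.1 hu
      have hX0 := hl.ne_zero X hX
      have hY0 := hl.ne_zero Y hY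
      obtain ⟨i, hi', rfl⟩ := List.mem_iff_getElem.1 hX
      obtain ⟨j, hj', rfl⟩ := List.mem_iff_getElem.1 hY
      simp only [L] at h1 h2 ⊢
      rcases lt_trichotomy i j with hij | rfl | hij
      · exact hi _ _ hX0 (hpw i j hi' hj' hij) h1 h2
      · rfl
      · exact (hi _ _ hY0 (hpw j i hj' hi' hij) h1.symm (h1 ▸ h2)).symm
    · intro j hj
      by_contra! hall
      have hidx : ∀ g : ZMod p, ∃ i : Fin l.length, L l[i] = (g, j) := by
        intro g
        obtain ⟨X, hX, hXg⟩ := List.mem_map.1 (hall g)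
        obtain ⟨i, hi', rfl⟩ := List.mem_iff_getElem.1 hX
        exact ⟨⟨i, hi'⟩, hXg⟩
      choose idx hidx using hidx
      have hinj : Function.Injective idx := fun g g' hgg => by
        have := hidx g
        rw [hgg, hidx g'] at this
        exact (Prod.ext_iff.1 this).1.symm
      let S : Finset (Fin l.length) := Finset.univ.image idx
      have hS : S.card = p := by
        rw [Finset.card_image_of_injective _ hinj, Finset.card_univ, ZMod.card]
      have hmem : ∀ a : Fin p, ∃ g, idx g = S.orderEmbOfFin hS a := fun a => by
        obtain ⟨g, _, hg⟩ := Finset.mem_image.1 (S.orderEmbOfFin_mem hS a)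
        exact ⟨g, hg⟩
      choose sgn hsgn using hmem
      have hL : ∀ a : Fin p, L l[S.orderEmbOfFin hS a] = (sgn a, j) := fun a => by
        simpa only [hsgn a] using hidx (sgn a)
      obtain ⟨a, b, hab, h⟩ := hii (fun a => l[S.orderEmbOfFin hS a])
        (fun a => hl.ne_zero _ (List.getElem_mem _))
        (fun a b hab => by
          rcases hab.lt_or_eq with hab | rfl
          · exact hpw _ _ _ _ ((S.orderEmbOfFin hS).strictMono hab)
          · exact ZpTucker.Ext.refl _)
        (fun a b => (congrArg Prod.snd (hL a)).trans (congrArg Prod.snd (hL b)).symm)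
        (fun a => (Nat.succ_le_of_lt hj).trans_eq (congrArg Prod.snd (hL a)).symm)
      have hsg : sgn a = sgn b :=
        (congrArg Prod.fst (hL a)).symm.trans (h.trans (congrArg Prod.fst (hL b)))
      refine hab ((S.orderEmbOfFin hS).injective ?_)
      rw [← hsgn a, ← hsgn b, hsg]
  obtain ⟨a, halt, ha0, ha⟩ := ZpTucker.exists_cochain_sequence p α m
  obtain ⟨l, hl, hne⟩ := ZpTucker.exists_flag_ne_zero (p := p) (n := n)
    (c := fun r l => a r (l.map L)) (by simpa using ha0) fun r l hl => by
      have hcomm : ∀ g, (l.map (ZpTucker.act g)).map L = (l.map L).map (ZpTucker.shift g) := by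
        intro g
        simp only [List.map_map]
        refine List.map_congr_left fun X hX => ?_
        have hX0 := hl.ne_zero X hX
        exact Prod.ext (hequiv1 g X hX0) (hequiv2 g X hX0)
      rw [ZpTucker.cobdry_map, ha r _ (hsimp _ _ hl)]
      simp only [ZpTucker.normDiff, hcomm]
  refine hne ((halt n).eq_zero_of_not_nodup ((hsimp n l hl).not_nodup hα ?_))
  simpa [hl.length_eq] using hlt
end

section
/- Let p be prime and n ≥ pk. Then the chromatic number of the almost 2-stable Kneser hypergraph KG^p([n] choose k)~_{2-stab} is at least ⌈(n-(k-1)p)/(p-1)⌉. -/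
/-- `S` has all pairwise distances at least `s`. -/
def stab (s : ℕ) (S : Finset ℕ) : Prop :=
  ∀ i ∈ S, ∀ j ∈ S, i ≠ j → i + s ≤ j ∨ j + s ≤ i

/-- `V n k s`: the `k`-subsets of `[n] = {1,…,n}` with pairwise distances at least `s`. -/
def V (n k s : ℕ) : Set (Finset ℕ) :=
  {S | S ⊆ Finset.Icc 1 n ∧ S.card = k ∧ stab s S}

/-- `c` is a proper coloring of the almost `s`-stable Kneser hypergraph
`KG^r([n] choose k)~_{s-stab}`: no `r`-tuple of pairwise disjoint vertices is
monochromatic. -/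
def IsProperCol (r n k s t : ℕ) (c : Finset ℕ → Fin t) : Prop :=
  ∀ f : Fin r → Finset ℕ, (∀ i, f i ∈ V n k s) →
    (∀ i j, i ≠ j → Disjoint (f i) (f j)) → ∃ i j, c (f i) ≠ c (f j)

section Cochains

variable {α β R : Type*} [CommRing R]

/-- The simplicial coboundary of a cochain on lists (with augmentation on the empty list). -/
def cobd : (List α → R) → List α → R
  | _, [] => 0
  | F, x :: l => F l - cobd (fun l' => F (x :: l')) l

@[simp]
theorem cobd_nil (F : List α → R) : cobd F [] = 0 := rfl

theorem cobd_cons (F : List α → R) (x : α) (l : List α) :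
    cobd F (x :: l) = F l - cobd (fun l' => F (x :: l')) l := rfl

theorem cobd_sub (F G : List α → R) (l : List α) :
    cobd (fun l' => F l' - G l') l = cobd F l - cobd G l := by
  induction l generalizing F G with
  | nil => simp
  | cons x l ih => simp only [cobd_cons, ih]; ring

theorem cobd_zero (l : List α) : cobd (fun _ => (0 : R)) l = 0 := by
  simpa using cobd_sub (fun _ => (0 : R)) (fun _ => 0) l

theorem cobd_sum {ι : Type*} (s : Finset ι) (F : ι → List α → R) (l : List α) :
    cobd (fun l' => ∑ i ∈ s, F i l') l = ∑ i ∈ s, cobd (F i) l := by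
  induction l generalizing F with
  | nil => simp
  | cons x l ih => simp only [cobd_cons, ih, Finset.sum_sub_distrib]

theorem cobd_cobd (F : List α → R) (l : List α) : cobd (cobd F) l = 0 := by
  induction l generalizing F with
  | nil => rfl
  | cons x l ih => simp only [cobd_cons, cobd_sub, ih]; ring

theorem cobd_comp_map (f : α → β) (F : List β → R) (l : List α) :
    cobd (fun l' => F (l'.map f)) l = cobd F (l.map f) := by
  induction l generalizing F with
  | nil => rfl
  | cons x l ih =>
    simp only [cobd_cons, List.map_cons]
    rw [← ih]

/-- A cochain is normalized if it vanishes on lists with two equal consecutive entries. -/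
def Normalized (F : List α → R) : Prop :=
  ∀ l : List α, ¬ l.IsChain (· ≠ ·) → F l = 0

theorem Normalized.cobd {F : List α → R} (hF : Normalized F) : Normalized (cobd F) := by
  intro l
  induction l generalizing F with
  | nil => simp
  | cons x l ih =>
    intro h
    have hx : Normalized fun l' => F (x :: l') := fun l' hl' => hF _ fun hc => hl' hc.tail
    cases l with
    | nil => simp at h
    | cons y l =>
      by_cases hl : (y :: l).IsChain (· ≠ ·)
      · obtain rfl : x = y := by
          by_contra hxy
          exact h (List.isChain_cons_cons.2 ⟨hxy, hl⟩)
        have h0 : (fun l' => F (x :: x :: l')) = fun _ => 0 :=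
          funext fun l' => hF _ (by simp)
        simp only [cobd_cons, h0, cobd_zero]
        ring
      · rw [cobd_cons, hF _ hl, ih hx hl, sub_zero]

/-- The prism operator between the identity and the map `m`. -/
def prism (m : α → α) : (List α → R) → List α → R
  | _, [] => 0
  | F, x :: l => F (x :: (x :: l).map m) - prism m (fun l' => F (x :: l')) l

theorem prism_cons (m : α → α) (F : List α → R) (x : α) (l : List α) :
    prism m F (x :: l) = F (x :: m x :: l.map m) - prism m (fun l' => F (x :: l')) l := rfl

theorem prism_sub (m : α → α) (F G : List α → R) (l : List α) :
    prism m (fun l' => F l' - G l') l = prism m F l - prism m G l := by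
  induction l generalizing F G with
  | nil => simp [prism]
  | cons x l ih => simp only [prism_cons, ih]; ring

theorem prism_congr (m : α → α) {F G : List α → R} {l : List α}
    (h : ∀ l₁ x l₂, l = l₁ ++ x :: l₂ →
      F (l₁ ++ x :: m x :: l₂.map m) = G (l₁ ++ x :: m x :: l₂.map m)) :
    prism m F l = prism m G l := by
  induction l generalizing F G with
  | nil => rfl
  | cons x l ih =>
    rw [prism_cons, prism_cons]
    refine congrArg₂ _ (h [] x l rfl) (ih ?_)
    exact fun l₁ y l₂ hl => h (x :: l₁) y l₂ (by simp [hl])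

theorem cobd_prism (m : α → α) (F : List α → R) (l : List α) :
    cobd (prism m F) l + prism m (cobd F) l = F (l.map m) - F l := by
  induction l generalizing F with
  | nil => simp [prism]
  | cons x l ih =>
    have h := ih fun l' => F (x :: l')
    have h' := cobd_comp_map m (fun l' => F (x :: m x :: l')) l
    simp only [cobd_cons, prism_cons, prism_sub, cobd_sub, List.map_cons] at h h' ⊢
    linear_combination h - h'

/-- The cochain contraction that first pushes along `m` and then cones off with apex `v`. -/
def contr (m : α → α) (v : α) (F : List α → R) (l : List α) : R :=
  F (v :: l.map m) - prism m F l

theorem contr_sub (m : α → α) (v : α) (F G : List α → R) (l : List α) :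
    contr m v (fun l' => F l' - G l') l = contr m v F l - contr m v G l := by
  simp only [contr, prism_sub]; ring

theorem contr_cobd (m : α → α) (v : α) (F : List α → R) (l : List α) :
    contr m v (cobd F) l = F l - cobd (contr m v F) l := by
  have h := cobd_prism m F l
  have h' := cobd_comp_map m (fun l' => F (v :: l')) l
  unfold contr
  simp only [cobd_sub, cobd_cons] at h h' ⊢
  linear_combination h' - h

end Cochains

section Transfer

variable {p : ℕ} [NeZero p] {α β : Type*} [AddAction (ZMod p) α] [AddAction (ZMod p) β]

/-- The operators `1 - g` (for `d` even) and `1 + g + ⋯ + g ^ (p - 1)` (for `d` odd) on cochains,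
where `g` is the generator of the cyclic group of order `p`. -/
def resol (d : ℕ) (F : List α → ZMod p) (l : List α) : ZMod p :=
  if Even d then F l - F (l.map ((1 : ZMod p) +ᵥ ·)) else ∑ g : ZMod p, F (l.map (g +ᵥ ·))

theorem resol_sub (d : ℕ) (F G : List α → ZMod p) (l : List α) :
    resol d (fun l' => F l' - G l') l = resol d F l - resol d G l := by
  unfold resol
  split_ifs
  · ring
  · rw [Finset.sum_sub_distrib]

omit [NeZero p] in
theorem map_vadd_map_vadd (g h : ZMod p) (l : List α) :
    (l.map (h +ᵥ ·)).map (g +ᵥ ·) = l.map ((g + h) +ᵥ ·) := by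
  simp [add_vadd]

theorem resol_resol_succ (d : ℕ) (F : List α → ZMod p) (l : List α) :
    resol d (resol (d + 1) F) l = 0 := by
  unfold resol
  by_cases hd : Even d
  · simp only [hd, Nat.even_add_one, not_true, if_true, if_false, map_vadd_map_vadd]
    rw [sub_eq_zero]
    exact (Equiv.sum_comp (Equiv.addRight (1 : ZMod p)) fun g => F (l.map (g +ᵥ ·))).symm
  · simp only [hd, Nat.even_add_one, not_false_eq_true, if_true, if_false, map_vadd_map_vadd]
    rw [Finset.sum_sub_distrib, sub_eq_zero]
    exact (Equiv.sum_comp (Equiv.addLeft (1 : ZMod p)) fun g => F (l.map (g +ᵥ ·))).symm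

theorem cobd_resol (d : ℕ) (F : List α → ZMod p) (l : List α) :
    cobd (resol d F) l = resol d (cobd F) l := by
  unfold resol
  split_ifs
  · rw [cobd_sub, cobd_comp_map]
  · rw [cobd_sum]
    exact Finset.sum_congr rfl fun g _ => cobd_comp_map _ _ _

theorem resol_comp_map (d : ℕ) (F : List β → ZMod p) (s : α → β) (l : List α)
    (hs : ∀ x ∈ l, ∀ g : ZMod p, s (g +ᵥ x) = g +ᵥ s x) :
    resol d F (l.map s) = resol d (fun l' => F (l'.map s)) l := by
  have h (g : ZMod p) : (l.map s).map (g +ᵥ ·) = (l.map (g +ᵥ ·)).map s := by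
    simp only [List.map_map]
    exact List.map_congr_left fun x hx => (hs x hx g).symm
  simp only [resol, h]

omit [NeZero p] in
theorem isChain_map_vadd (g : ZMod p) (l : List α) :
    (l.map (g +ᵥ ·)).IsChain (· ≠ ·) ↔ l.IsChain (· ≠ ·) := by
  rw [List.isChain_map]
  simp

end Transfer

section Bar

variable {p : ℕ} [NeZero p]

theorem exists_resol_eq_of_odd {d : ℕ} (hd : ¬ Even d) {φ : List (ZMod p) → ZMod p}
    (hφ : Normalized φ) (h0 : φ [] = 0) (hinv : ∀ l, φ l = φ (l.map ((1 : ZMod p) +ᵥ ·))) :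
    ∃ ψ, Normalized ψ ∧ ∀ l, resol d ψ l = φ l := by
  have hinv' (j : ℕ) (l : List (ZMod p)) : φ (l.map ((j : ZMod p) +ᵥ ·)) = φ l := by
    induction j with
    | zero => simp
    | succ j ih => rw [← ih, hinv (l.map ((j : ZMod p) +ᵥ ·)), map_vadd_map_vadd, Nat.cast_succ, add_comm]
  refine ⟨fun l => if l.head? = some 0 then φ l else 0, fun l hl => ?_, fun l => ?_⟩
  · simp [hφ l hl]
  · simp only [resol, hd, if_false]
    cases l with
    | nil => simp [h0]
    | cons x l =>
      rw [Finset.sum_eq_single (-x)]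
      · have := hinv' (-x).val (x :: l)
        rw [ZMod.natCast_zmod_val] at this
        rw [this]; simp
      · intro b _ hb
        have : b + x ≠ 0 := fun h => hb (eq_neg_of_add_eq_zero_left h)
        simp [this]
      · simp

theorem sum_range_natCast {M : Type*} [AddCommMonoid M] (f : ZMod p → M) :
    ∑ j ∈ Finset.range p, f j = ∑ g : ZMod p, f g :=
  Finset.sum_nbij' (fun j => (j : ZMod p)) ZMod.val (by simp)
    (fun g _ => Finset.mem_range.2 g.val_lt)
    (fun j hj => ZMod.val_cast_of_lt (Finset.mem_range.1 hj)) (by simp) (by simp)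

theorem exists_resol_eq_of_even {d : ℕ} (hd : Even d) {φ : List (ZMod p) → ZMod p}
    (hφ : Normalized φ) (h0 : φ [] = 0) (hsum : ∀ l : List (ZMod p), ∑ g : ZMod p, φ (l.map (g +ᵥ ·)) = 0) :
    ∃ ψ, Normalized ψ ∧ ∀ l, resol d ψ l = φ l := by
  refine ⟨fun l : List (ZMod p) => -∑ j ∈ Finset.range (l.headD 0).val,
    φ (l.map (((j : ZMod p) - l.headD 0) +ᵥ ·)), fun l hl => ?_, fun l => ?_⟩
  · rw [neg_eq_zero]
    exact Finset.sum_eq_zero fun j _ => hφ _ (by rwa [isChain_map_vadd])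
  · simp only [resol, hd, if_true]
    cases l with
    | nil => simp [h0]
    | cons x l =>
      set f : ZMod p → ZMod p := fun j => φ ((x :: l).map ((j - x) +ᵥ ·)) with hf
      have hsucc (j : ZMod p) :
          φ (((x :: l).map ((1 : ZMod p) +ᵥ ·)).map ((j - (1 + x)) +ᵥ ·)) = f j := by
        rw [map_vadd_map_vadd, show j - (1 + x) + 1 = j - x by ring]
      have hhead : ((x :: l).map ((1 : ZMod p) +ᵥ ·)).headD 0 = 1 + x := rfl
      have hfx : f x = φ (x :: l) := by simp [hf]
      have htot : ∑ j ∈ Finset.range p, f j = 0 := by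
        rw [sum_range_natCast, ← hsum (x :: l)]
        exact Equiv.sum_comp (Equiv.subRight x) fun g => φ ((x :: l).map (g +ᵥ ·))
      simp only [hhead, hsucc]
      rw [← hfx]
      change -∑ j ∈ Finset.range x.val, f j - _ = _
      have hx : ∑ j ∈ Finset.range (x.val + 1), f j = ∑ j ∈ Finset.range x.val, f j + f x := by
        rw [Finset.sum_range_succ, ZMod.natCast_zmod_val]
      rcases (Nat.succ_le_of_lt x.val_lt).lt_or_eq with hlt | heq
      · have : (1 + x).val = x.val + 1 := by
          rw [← ZMod.natCast_zmod_val x, add_comm, ← Nat.cast_succ, ZMod.val_cast_of_lt hlt,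
            ZMod.natCast_zmod_val]
        rw [this, hx]
        ring
      · have : (1 + x) = 0 := by
          rw [← ZMod.natCast_zmod_val x, add_comm]
          exact_mod_cast (congrArg (Nat.cast : ℕ → ZMod p) heq).trans (ZMod.natCast_self p)
        have hrange : Finset.range (x.val + 1) = Finset.range p := congrArg _ heq
        rw [← hrange, hx] at htot
        rw [this, ZMod.val_zero, Finset.sum_range_zero]
        linear_combination -htot

theorem exists_resol_eq (d : ℕ) {φ : List (ZMod p) → ZMod p}
    (hφ : Normalized φ) (h0 : φ [] = 0) (h : ∀ l, resol (d + 1) φ l = 0) :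
    ∃ ψ, Normalized ψ ∧ ∀ l, resol d ψ l = φ l := by
  by_cases hd : Even d
  · refine exists_resol_eq_of_even hd hφ h0 fun l => ?_
    simpa [resol, Nat.even_add_one, hd] using h l
  · refine exists_resol_eq_of_odd hd hφ h0 fun l => ?_
    simpa [resol, Nat.even_add_one, hd, sub_eq_zero] using h l

end Bar

section SignedVectors

variable {p : ℕ}

instance : AddAction (ZMod p) (Option (ZMod p)) where
  zero_vadd x := by cases x <;> simp
  add_vadd g h x := by cases x <;> simp [add_assoc]

/-- The face order on signed vectors. -/
def FaceLE (x y : ℕ → Option (ZMod p)) : Prop :=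
  ∀ i, x i ≠ none → y i = x i

/-- Nonzero signed vectors supported in `[n]`. -/
def IsFace (n : ℕ) (x : ℕ → Option (ZMod p)) : Prop :=
  (∃ i, x i ≠ none) ∧ ∀ i, x i ≠ none → i ∈ Finset.Icc 1 n

/-- Weak flags with `d` entries of nonzero signed vectors supported in `[n]`. -/
structure IsFlag (n d : ℕ) (l : List (ℕ → Option (ZMod p))) : Prop where
  length_eq : l.length = d
  face : ∀ x ∈ l, IsFace n x
  pairwise : l.Pairwise FaceLE

theorem vadd_apply_ne_none (g : ZMod p) (x : ℕ → Option (ZMod p)) (i : ℕ) :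
    (g +ᵥ x) i ≠ none ↔ x i ≠ none := by
  rw [Pi.vadd_apply]
  cases x i <;> simp

theorem FaceLE.vadd {x y : ℕ → Option (ZMod p)} (h : FaceLE x y) (g : ZMod p) :
    FaceLE (g +ᵥ x) (g +ᵥ y) := by
  intro i hi
  rw [vadd_apply_ne_none] at hi
  rw [Pi.vadd_apply, Pi.vadd_apply, h i hi]

theorem IsFace.vadd {n : ℕ} {x : ℕ → Option (ZMod p)} (h : IsFace n x) (g : ZMod p) :
    IsFace n (g +ᵥ x) := by
  simpa only [IsFace, vadd_apply_ne_none] using h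

theorem IsFlag.vadd {n d : ℕ} {l : List (ℕ → Option (ZMod p))} (h : IsFlag n d l) (g : ZMod p) :
    IsFlag n d (l.map (g +ᵥ ·)) where
  length_eq := by simp [h.length_eq]
  face := by
    simp only [List.mem_map, forall_exists_index, and_imp]
    rintro _ x hx rfl
    exact (h.face x hx).vadd g
  pairwise := List.pairwise_map.2 (h.pairwise.imp fun hxy => hxy.vadd g)

theorem IsFace.mono {n m : ℕ} (hnm : n ≤ m) {x : ℕ → Option (ZMod p)} (h : IsFace n x) :
    IsFace m x :=
  ⟨h.1, fun i hi => Finset.Icc_subset_Icc_right hnm (h.2 i hi)⟩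

theorem IsFace.update {n : ℕ} {x : ℕ → Option (ZMod p)} (h : IsFace n x) :
    IsFace (n + 1) (Function.update x (n + 1) (some 0)) := by
  refine ⟨⟨n + 1, by simp⟩, fun i hi => ?_⟩
  rcases eq_or_ne i (n + 1) with rfl | hne
  · simp
  · rw [Function.update_of_ne hne] at hi
    exact Finset.Icc_subset_Icc_right n.le_succ (h.2 i hi)

theorem FaceLE.update {x y : ℕ → Option (ZMod p)} (h : FaceLE x y) (n : ℕ) (a : ZMod p) :
    FaceLE (Function.update x n (some a)) (Function.update y n (some a)) := by
  intro i hi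
  rcases eq_or_ne i n with rfl | hne
  · simp
  · rw [Function.update_of_ne hne] at hi ⊢
    rw [Function.update_of_ne hne, h i hi]

theorem IsFace.faceLE_update {n : ℕ} {x y : ℕ → Option (ZMod p)} (hx : IsFace n x)
    (h : FaceLE x y) (a : ZMod p) : FaceLE x (Function.update y (n + 1) (some a)) := by
  intro i hi
  have := Finset.mem_Icc.1 (hx.2 i hi)
  rw [Function.update_of_ne (by lia), h i hi]

/-- The vertex with sign `0` at position `n`. -/
def apex (p n : ℕ) : ℕ → Option (ZMod p) :=
  Function.update (fun _ => none) n (some 0)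

theorem isFace_apex (p n : ℕ) : IsFace (n + 1) (apex p (n + 1)) := by
  refine ⟨⟨n + 1, by simp [apex]⟩, fun i hi => ?_⟩
  rcases eq_or_ne i (n + 1) with rfl | hne
  · simp
  · simp [apex, Function.update_of_ne hne] at hi

theorem apex_faceLE (n : ℕ) (x : ℕ → Option (ZMod p)) :
    FaceLE (apex p n) (Function.update x n (some 0)) := by
  intro i hi
  rcases eq_or_ne i n with rfl | hne
  · simp [apex]
  · simp [apex, Function.update_of_ne hne] at hi

/-- Contraction of the cochains of the complex of signed vectors, coning off with the vertex at
position `n`. -/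
def faceContr (n : ℕ) : (List (ℕ → Option (ZMod p)) → ZMod p) →
    List (ℕ → Option (ZMod p)) → ZMod p :=
  contr (fun x => Function.update x n (some 0)) (apex p n)

theorem faceContr_congr {n d : ℕ} {F G : List (ℕ → Option (ZMod p)) → ZMod p}
    (h : ∀ l, IsFlag (n + 1) (d + 1) l → F l = G l) {l : List (ℕ → Option (ZMod p))}
    (hl : IsFlag n d l) : faceContr (n + 1) F l = faceContr (n + 1) G l := by
  unfold faceContr contr
  refine congrArg₂ _ (h _ ?_) (prism_congr _ ?_)
  · refine ⟨by simp [hl.length_eq], ?_, ?_⟩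
    · simp only [List.mem_cons, List.mem_map]
      rintro x (rfl | ⟨y, hy, rfl⟩)
      · exact isFace_apex p n
      · exact (hl.face y hy).update
    · refine List.pairwise_cons.2 ⟨?_, List.pairwise_map.2 (hl.pairwise.imp fun hxy => hxy.update _ _)⟩
      simp only [List.mem_map]
      rintro x ⟨y, hy, rfl⟩
      exact apex_faceLE _ _
  · rintro l₁ x l₂ rfl
    obtain ⟨hlen, hface, hpw⟩ := hl
    have hrefl (y : ℕ → Option (ZMod p)) : FaceLE y y := fun _ _ => rfl
    simp only [List.pairwise_append, List.pairwise_cons, List.mem_cons, List.mem_append] at hface hpw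
    refine h _ ⟨by simp at hlen ⊢; lia, ?_, ?_⟩
    · simp only [List.mem_cons, List.mem_map, List.mem_append]
      rintro y (hy | rfl | rfl | ⟨z, hz, rfl⟩)
      · exact (hface y (.inl hy)).mono n.le_succ
      · exact (hface y (.inr (.inl rfl))).mono n.le_succ
      · exact (hface x (.inr (.inl rfl))).update
      · exact (hface z (.inr (.inr hz))).update
    · simp only [List.pairwise_append, List.pairwise_cons, List.mem_cons, List.mem_map,
        List.pairwise_map]
      refine ⟨hpw.1, ⟨?_, ?_, hpw.2.1.2.imp fun hxy => hxy.update _ _⟩, ?_⟩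
      · rintro y (rfl | ⟨z, hz, rfl⟩)
        · exact (hface x (.inr (.inl rfl))).faceLE_update (hrefl x) 0
        · exact (hface x (.inr (.inl rfl))).faceLE_update (hpw.2.1.1 z hz) 0
      · rintro _ ⟨z, hz, rfl⟩
        exact (hpw.2.1.1 z hz).update _ _
      · rintro y hy _ (rfl | rfl | ⟨z, hz, rfl⟩)
        · exact hpw.2.2 y hy _ (.inl rfl)
        · exact (hface y (.inl hy)).faceLE_update (hpw.2.2 y hy _ (.inl rfl)) 0
        · exact (hface y (.inl hy)).faceLE_update (hpw.2.2 y hy z (.inr hz)) 0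

variable [NeZero p]

/-- Evaluation of cochains on the `d`-dimensional chains `c₀, c₁, …` with
`∂ c₁ = (1 - g) c₀`, `∂ c₂ = (1 + g + ⋯ + g ^ (p - 1)) c₁`, and so on. -/
def chainEval : ℕ → (List (ℕ → Option (ZMod p)) → ZMod p) → ZMod p
  | 0, F => F [apex p 1]
  | d + 1, F => chainEval d (resol d (faceContr (d + 2) F))

theorem chainEval_sub (d : ℕ) (F G : List (ℕ → Option (ZMod p)) → ZMod p) :
    chainEval d (fun l => F l - G l) = chainEval d F - chainEval d G := by
  induction d generalizing F G with
  | zero => rfl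
  | succ d ih =>
    rw [chainEval, chainEval, chainEval, ← ih]
    congr 1
    funext l
    rw [← resol_sub]
    congr 1
    funext l
    exact contr_sub _ _ _ _ _

theorem chainEval_zero (d : ℕ) : chainEval (p := p) d (fun _ => 0) = 0 := by
  simpa using chainEval_sub (p := p) d (fun _ => 0) (fun _ => 0)

theorem resol_congr {n d : ℕ} (e : ℕ) {F G : List (ℕ → Option (ZMod p)) → ZMod p}
    (h : ∀ l, IsFlag n d l → F l = G l) {l : List (ℕ → Option (ZMod p))}
    (hl : IsFlag n d l) : resol e F l = resol e G l := by
  simp only [resol, h l hl, fun g => h _ (hl.vadd g)]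

theorem chainEval_congr {d : ℕ} {F G : List (ℕ → Option (ZMod p)) → ZMod p}
    (h : ∀ l, IsFlag (d + 1) (d + 1) l → F l = G l) : chainEval d F = chainEval d G := by
  induction d generalizing F G with
  | zero =>
    refine h _ ⟨rfl, ?_, List.pairwise_singleton _ _⟩
    simpa using isFace_apex p 0
  | succ d ih => exact ih fun l hl => resol_congr d (fun l hl => faceContr_congr h hl) hl

theorem chainEval_succ_cobd (d : ℕ) (F : List (ℕ → Option (ZMod p)) → ZMod p) :
    chainEval (d + 1) (cobd F) = chainEval d (resol d F) := by
  induction d generalizing F with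
  | zero =>
    rw [chainEval, chainEval, chainEval]
    simp [resol, faceContr, contr_cobd, cobd_cons]
  | succ d ih =>
    have h : resol (d + 1) (faceContr (d + 3) (cobd F)) = fun l =>
        resol (d + 1) F l - cobd (resol (d + 1) (faceContr (d + 3) F)) l := by
      funext l
      rw [cobd_resol, ← resol_sub]
      congr 1
      funext l
      exact contr_cobd _ _ _ _
    rw [chainEval, h, chainEval_sub, ih]
    rw [show resol d (resol (d + 1) (faceContr (d + 3) F)) = fun _ => 0 from
      funext fun l => resol_resol_succ d _ l, chainEval_zero, sub_zero]

/-- For every equivariant sign function on signed vectors, the standard cocycle of the cyclic group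
evaluates to `1`. -/
theorem exists_normalized_chainEval_eq_one (n d : ℕ) (hd : d < n)
    (s : (ℕ → Option (ZMod p)) → ZMod p)
    (hs : ∀ x, IsFace n x → ∀ g : ZMod p, s (g +ᵥ x) = g + s x) :
    ∃ η : List (ZMod p) → ZMod p, Normalized (cobd η) ∧ (∀ l, resol (d + 1) (cobd η) l = 0) ∧
      chainEval d (fun l => cobd η (l.map s)) = 1 := by
  induction d with
  | zero =>
    have h0 (l : List (ZMod p)) : cobd (fun l => if l = [] then (1 : ZMod p) else 0) l =
        if l.length = 1 then 1 else 0 := by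
      cases l with
      | nil => simp
      | cons x l => simp [cobd_cons, cobd_zero]
    refine ⟨fun l => if l = [] then 1 else 0, fun l hl => ?_, fun l => ?_, ?_⟩
    · rw [h0, if_neg]
      intro h
      obtain ⟨a, rfl⟩ := List.length_eq_one_iff.1 h
      simp at hl
    · simp [resol, h0]
    · simp [chainEval, h0]
  | succ d ih =>
    obtain ⟨η, hη, hres, hval⟩ := ih (by lia)
    obtain ⟨ψ, hψ, hψη⟩ := exists_resol_eq d hη (cobd_nil η) hres
    refine ⟨ψ, hψ.cobd, fun l => ?_, ?_⟩
    · have h : resol (d + 1 + 1) (cobd ψ) l = resol d (cobd ψ) l := by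
        simp [resol, Nat.even_add_one]
      rw [h, ← cobd_resol, funext hψη, cobd_cobd]
    · have h : (fun l : List (ℕ → Option (ZMod p)) => cobd ψ (l.map s)) =
          cobd (fun l => ψ (l.map s)) := funext fun l => (cobd_comp_map s ψ l).symm
      rw [h, chainEval_succ_cobd, ← hval]
      refine chainEval_congr fun l hl => ?_
      rw [← hψη, resol_comp_map]
      exact fun x hx g => hs x ((hl.face x hx).mono (by lia)) g

omit [NeZero p] in
theorem isChain_map_lt {n : ℕ} {s : (ℕ → Option (ZMod p)) → ZMod p}
    {r : (ℕ → Option (ZMod p)) → ℕ}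
    (hr : ∀ x y, IsFace n x → IsFace n y → FaceLE x y → r x ≤ r y)
    (hrs : ∀ x y, IsFace n x → IsFace n y → FaceLE x y → r x = r y → s x = s y)
    {l : List (ℕ → Option (ZMod p))} (hface : ∀ x ∈ l, IsFace n x) (hpw : l.Pairwise FaceLE)
    (hs : (l.map s).IsChain (· ≠ ·)) : (l.map r).IsChain (· < ·) := by
  induction l with
  | nil => simp
  | cons x l ih =>
    cases l with
    | nil => simp
    | cons y l =>
      simp only [List.map_cons, List.isChain_cons_cons] at hs ih ⊢
      have hx := hface x (by simp)
      have hy := hface y (by simp)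
      have hxy := (List.pairwise_cons.1 hpw).1 y (by simp)
      exact ⟨(hr x y hx hy hxy).lt_of_ne fun h => hs.1 (hrs x y hx hy hxy h),
        ih (fun z hz => hface z (List.mem_cons_of_mem _ hz)) (List.pairwise_cons.1 hpw).2 hs.2⟩

/-- A Tucker-type lemma for the cyclic group of order `p`. -/
theorem le_of_equivariant_labelling {n m : ℕ} (hp : 1 < p)
    {s : (ℕ → Option (ZMod p)) → ZMod p} {r : (ℕ → Option (ZMod p)) → ℕ}
    (hs : ∀ x, IsFace n x → ∀ g : ZMod p, s (g +ᵥ x) = g + s x)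
    (hmem : ∀ x, IsFace n x → r x ∈ Finset.Icc 1 m)
    (hr : ∀ x y, IsFace n x → IsFace n y → FaceLE x y → r x ≤ r y)
    (hrs : ∀ x y, IsFace n x → IsFace n y → FaceLE x y → r x = r y → s x = s y) : n ≤ m := by
  have : Fact (1 < p) := ⟨hp⟩
  cases n with
  | zero => exact m.zero_le
  | succ n =>
    by_contra hlt
    obtain ⟨η, hη, -, hval⟩ := exists_normalized_chainEval_eq_one (n + 1) n n.lt_succ_self s hs
    refine zero_ne_one (α := ZMod p) ?_
    rw [← hval, ← chainEval_zero n]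
    refine chainEval_congr fun l hl => (hη _ fun hc => hlt ?_).symm
    have hnodup : (l.map r).Nodup :=
      ((isChain_map_lt hr hrs hl.face hl.pairwise hc).pairwise).imp ne_of_lt
    have hsub : (l.map r).toFinset ⊆ Finset.Icc 1 m := by
      intro a ha
      obtain ⟨x, hx, rfl⟩ := List.mem_map.1 (List.mem_toFinset.1 ha)
      exact hmem x (hl.face x hx)
    have := Finset.card_le_card hsub
    rwa [List.toFinset_card_of_nodup hnodup, List.length_map, hl.length_eq, Nat.card_Icc,
      Nat.add_sub_cancel] at this

end SignedVectors


section Alternation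

variable {p : ℕ}

/-- `A` is contained in the support of `x`, and `x` has distinct signs at any two consecutive
elements of `A`. -/
def AltOn (x : ℕ → Option (ZMod p)) (A : Finset ℕ) : Prop :=
  (∀ i ∈ A, x i ≠ none) ∧
    ∀ i ∈ A, ∀ j ∈ A, i < j → (∀ l ∈ A, ¬ (i < l ∧ l < j)) → x i ≠ x j

theorem AltOn.mono {x y : ℕ → Option (ZMod p)} (hxy : FaceLE x y) {A : Finset ℕ}
    (h : AltOn x A) : AltOn y A := by
  refine ⟨fun i hi => ?_, fun i hi j hj hij hl => ?_⟩
  · rw [hxy i (h.1 i hi)]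
    exact h.1 i hi
  · rw [hxy i (h.1 i hi), hxy j (h.1 j hj)]
    exact h.2 i hi j hj hij hl

theorem AltOn.vadd {x : ℕ → Option (ZMod p)} {A : Finset ℕ} (h : AltOn x A) (g : ZMod p) :
    AltOn (g +ᵥ x) A := by
  refine ⟨fun i hi => (vadd_apply_ne_none g x i).2 (h.1 i hi), fun i hi j hj hij hl => ?_⟩
  rw [Pi.vadd_apply, Pi.vadd_apply]
  exact fun he => h.2 i hi j hj hij hl (vadd_left_cancel g he)

open Classical in
/-- The maximal length of an alternating subsequence of `x` in `[n]`. -/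
noncomputable def alt (n : ℕ) (x : ℕ → Option (ZMod p)) : ℕ :=
  ((Finset.Icc 1 n).powerset.filter (AltOn x)).sup Finset.card

theorem AltOn.card_le_alt {n : ℕ} {x : ℕ → Option (ZMod p)} {A : Finset ℕ} (h : AltOn x A)
    (hA : A ⊆ Finset.Icc 1 n) : A.card ≤ alt n x := by
  classical
  exact Finset.le_sup (f := Finset.card) (Finset.mem_filter.2 ⟨Finset.mem_powerset.2 hA, h⟩)

theorem exists_altOn_card_eq (n : ℕ) (x : ℕ → Option (ZMod p)) :
    ∃ A ⊆ Finset.Icc 1 n, AltOn x A ∧ A.card = alt n x := by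
  classical
  obtain ⟨A, hA, h⟩ := Finset.exists_mem_eq_sup
    ((Finset.Icc 1 n).powerset.filter (AltOn x)) ⟨∅, by simp [AltOn]⟩ Finset.card
  rw [Finset.mem_filter, Finset.mem_powerset] at hA
  exact ⟨A, hA.1, hA.2, h.symm⟩

theorem alt_mono {n : ℕ} {x y : ℕ → Option (ZMod p)} (hxy : FaceLE x y) :
    alt n x ≤ alt n y := by
  obtain ⟨A, hA, h, hc⟩ := exists_altOn_card_eq n x
  exact hc ▸ (h.mono hxy).card_le_alt hA

theorem alt_le_alt_vadd (n : ℕ) (x : ℕ → Option (ZMod p)) (g : ZMod p) :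
    alt n x ≤ alt n (g +ᵥ x) := by
  obtain ⟨A, hA, h, hc⟩ := exists_altOn_card_eq n x
  exact hc ▸ (h.vadd g).card_le_alt hA

theorem alt_vadd (n : ℕ) (x : ℕ → Option (ZMod p)) (g : ZMod p) : alt n (g +ᵥ x) = alt n x := by
  refine le_antisymm ?_ (alt_le_alt_vadd n x g)
  simpa using alt_le_alt_vadd n (g +ᵥ x) (-g)

theorem IsFace.alt_pos {n : ℕ} {x : ℕ → Option (ZMod p)} (hx : IsFace n x) : 0 < alt n x := by
  obtain ⟨i, hi⟩ := hx.1
  have h : AltOn x {i} := by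
    refine ⟨by simpa using hi, ?_⟩
    simp only [Finset.mem_singleton]
    rintro _ rfl _ rfl h
    exact absurd h (lt_irrefl _)
  exact h.card_le_alt (Finset.singleton_subset_iff.2 (hx.2 i hi))

/-- The first element of the support of `x`. -/
noncomputable def firstPos (x : ℕ → Option (ZMod p)) : ℕ := sInf {i | x i ≠ none}

theorem IsFace.apply_firstPos_ne_none {n : ℕ} {x : ℕ → Option (ZMod p)} (hx : IsFace n x) :
    x (firstPos x) ≠ none :=
  Nat.sInf_mem (s := {i | x i ≠ none}) hx.1

theorem firstPos_vadd (x : ℕ → Option (ZMod p)) (g : ZMod p) :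
    firstPos (g +ᵥ x) = firstPos x := by
  simp only [firstPos, vadd_apply_ne_none]

/-- The first nonzero sign of `x`. -/
noncomputable def firstSign (x : ℕ → Option (ZMod p)) : ZMod p := (x (firstPos x)).getD 0

theorem IsFace.firstSign_vadd {n : ℕ} {x : ℕ → Option (ZMod p)} (hx : IsFace n x) (g : ZMod p) :
    firstSign (g +ᵥ x) = g + firstSign x := by
  rw [firstSign, firstSign, firstPos_vadd, Pi.vadd_apply]
  obtain ⟨a, ha⟩ := Option.ne_none_iff_exists'.1 hx.apply_firstPos_ne_none
  simp [ha]

theorem AltOn.apply_min'_eq {n : ℕ} {x : ℕ → Option (ZMod p)} (hx : IsFace n x) {A : Finset ℕ}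
    (h : AltOn x A) (hA : A ⊆ Finset.Icc 1 n) (hc : A.card = alt n x) (hne : A.Nonempty) :
    x (A.min' hne) = x (firstPos x) := by
  by_contra hdiff
  have hmem := A.min'_mem hne
  have hf := hx.apply_firstPos_ne_none
  have hlt : firstPos x < A.min' hne :=
    (Nat.sInf_le (h.1 _ hmem)).lt_of_ne fun he => hdiff (he ▸ rfl)
  have hmin (j : ℕ) (hj : j ∈ A) : firstPos x < j := hlt.trans_le (A.min'_le j hj)
  have hins : AltOn x (insert (firstPos x) A) := by
    simp only [AltOn, Finset.mem_insert]
    refine ⟨?_, ?_⟩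
    · rintro i (rfl | hi)
      exacts [hf, h.1 i hi]
    · rintro i (rfl | hi) j (rfl | hj) hij hl
      · exact absurd hij (lt_irrefl _)
      · rcases (A.min'_le j hj).eq_or_lt with he | hlt'
        · exact he ▸ Ne.symm hdiff
        · exact absurd ⟨hlt, hlt'⟩ (hl _ (.inr hmem))
      · exact absurd hij (hmin i hi).asymm
      · exact h.2 i hi j hj hij fun l hlA => hl l (.inr hlA)
  have := hins.card_le_alt (Finset.insert_subset (hx.2 _ hf) hA)
  rw [Finset.card_insert_of_notMem fun hm => (hmin _ hm).false] at this
  lia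

theorem firstSign_eq_of_alt_eq {n : ℕ} {x y : ℕ → Option (ZMod p)} (hx : IsFace n x)
    (hy : IsFace n y) (hxy : FaceLE x y) (h : alt n x = alt n y) : firstSign x = firstSign y := by
  obtain ⟨A, hA, hAx, hc⟩ := exists_altOn_card_eq n x
  have hne : A.Nonempty := Finset.card_pos.1 (hc ▸ hx.alt_pos)
  rw [firstSign, firstSign, ← hAx.apply_min'_eq hx hA hc hne,
    ← (hAx.mono hxy).apply_min'_eq hy hA (hc.trans h) hne, hxy _ (hAx.1 _ (A.min'_mem hne))]

theorem AltOn.stab_filter {x : ℕ → Option (ZMod p)} {A : Finset ℕ} (h : AltOn x A) (a : ZMod p) :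
    stab 2 (A.filter fun i => x i = some a) := by
  have key (i j : ℕ) (hi : i ∈ A ∧ x i = some a) (hj : j ∈ A ∧ x j = some a) (hij : i < j) :
      i + 2 ≤ j := by
    by_contra hlt
    exact h.2 i hi.1 j hj.1 hij (fun l _ => by lia) (hi.2.trans hj.2.symm)
  intro i hi j hj hij
  rw [Finset.mem_filter] at hi hj
  rcases hij.lt_or_gt with hlt | hlt
  · exact .inl (key i j hi hj hlt)
  · exact .inr (key j i hj hi hlt)

/-- A signed vector with a long alternating subsequence contains a `2`-stable `k`-set of constant
sign. -/
theorem exists_mem_V_of_lt_alt [NeZero p] {n k : ℕ} {x : ℕ → Option (ZMod p)}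
    (h : p * (k - 1) < alt n x) : ∃ a, ∃ S ∈ V n k 2, ∀ i ∈ S, x i = some a := by
  obtain ⟨A, hA, hAx, hc⟩ := exists_altOn_card_eq n x
  obtain ⟨a, -, ha⟩ := Finset.exists_lt_card_fiber_of_mul_lt_card_of_maps_to
    (s := A) (t := Finset.univ) (f := fun i => (x i).getD 0) (n := k - 1)
    (fun _ _ => Finset.mem_univ _) (by rwa [Finset.card_univ, ZMod.card, hc])
  have hfil : (A.filter fun i => (x i).getD 0 = a) = A.filter fun i => x i = some a := by
    refine Finset.filter_congr fun i hi => ?_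
    obtain ⟨b, hb⟩ := Option.ne_none_iff_exists'.1 (hAx.1 i hi)
    simp [hb]
  rw [hfil] at ha
  obtain ⟨S, hS, hcard⟩ := Finset.exists_subset_card_eq
    (show k ≤ (A.filter fun i => x i = some a).card by lia)
  exact ⟨a, S, ⟨fun i hi => hA (Finset.mem_filter.1 (hS hi)).1, hcard,
    fun i hi j hj => hAx.stab_filter a i (hS hi) j (hS hj)⟩,
    fun i hi => (Finset.mem_filter.1 (hS hi)).2⟩

end Alternation

section Coloring

variable {p n k t : ℕ} [Fact p.Prime] {c : Finset ℕ → Fin t}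

open Classical in
/-- The signs `a` for which some stable `k`-set of color `j` lies in the part of `x` of sign `a`. -/
noncomputable def signsOf (n k : ℕ) (c : Finset ℕ → Fin t) (x : ℕ → Option (ZMod p))
    (j : Fin t) : Finset (ZMod p) :=
  {a | ∃ S ∈ V n k 2, c S = j ∧ ∀ i ∈ S, x i = some a}

theorem mem_signsOf {x : ℕ → Option (ZMod p)} {j : Fin t} {a : ZMod p} :
    a ∈ signsOf n k c x j ↔ ∃ S ∈ V n k 2, c S = j ∧ ∀ i ∈ S, x i = some a := by
  simp [signsOf]

theorem signsOf_mono {x y : ℕ → Option (ZMod p)} (hxy : FaceLE x y) (j : Fin t) :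
    signsOf n k c x j ⊆ signsOf n k c y j := by
  intro a ha
  obtain ⟨S, hS, hc, hx⟩ := mem_signsOf.1 ha
  refine mem_signsOf.2 ⟨S, hS, hc, fun i hi => ?_⟩
  rw [hxy i (by simp [hx i hi]), hx i hi]

theorem signsOf_vadd (x : ℕ → Option (ZMod p)) (j : Fin t) (g : ZMod p) :
    signsOf n k c (g +ᵥ x) j = (signsOf n k c x j).map (addLeftEmbedding g) := by
  ext a
  have h (i : ℕ) : (g +ᵥ x) i = some a ↔ x i = some (-g + a) := by
    rw [Pi.vadd_apply]
    cases x i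
    · simp
    · simp [eq_neg_add_iff_add_eq]
  simp only [Finset.mem_map, addLeftEmbedding_apply, mem_signsOf, h]
  constructor
  · exact fun hS => ⟨-g + a, hS, by simp⟩
  · rintro ⟨b, hS, rfl⟩
    simpa using hS

theorem card_signsOf_lt (hc : IsProperCol p n k 2 t c) (x : ℕ → Option (ZMod p)) (j : Fin t) :
    (signsOf n k c x j).card < p := by
  have hle : (signsOf n k c x j).card ≤ p := by
    simpa [ZMod.card] using (signsOf n k c x j).card_le_univ
  refine hle.lt_of_ne fun heq => ?_
  have huniv : signsOf n k c x j = Finset.univ :=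
    Finset.eq_univ_of_card _ (by rw [heq, ZMod.card])
  have hall (a : ZMod p) : ∃ S ∈ V n k 2, c S = j ∧ ∀ i ∈ S, x i = some a :=
    mem_signsOf.1 (huniv ▸ Finset.mem_univ a)
  choose S hS hcS hx using hall
  have e : Fin p ≃ ZMod p := Fintype.equivOfCardEq (by simp [ZMod.card])
  obtain ⟨u, v, huv⟩ := hc (fun u => S (e u)) (fun u => hS _) fun u v huv =>
    Finset.disjoint_left.2 fun i hu hv => huv <| e.injective <| by
      simpa using (hx _ i hu).symm.trans (hx _ i hv)
  exact huv ((hcS _).trans (hcS _).symm)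

/-- The mean of a nonempty member of the family `L`, chosen depending only on which members are
nonempty. -/
noncomputable def meanSign [Nonempty (Fin t)] (L : Fin t → Finset (ZMod p)) : ZMod p :=
  (∑ a ∈ L (Classical.epsilon fun j => (L j).Nonempty), a) /
    (L (Classical.epsilon fun j => (L j).Nonempty)).card

theorem meanSign_map [Nonempty (Fin t)] {L : Fin t → Finset (ZMod p)}
    (hL : ∃ j, (L j).Nonempty) (hlt : ∀ j, (L j).card < p) (g : ZMod p) :
    meanSign (fun j => (L j).map (addLeftEmbedding g)) = g + meanSign L := by
  unfold meanSign
  simp only [Finset.map_nonempty, Finset.sum_map, Finset.card_map, addLeftEmbedding_apply]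
  have hne := Classical.epsilon_spec hL
  set A := L (Classical.epsilon fun j => (L j).Nonempty)
  have h0 : (A.card : ZMod p) ≠ 0 := by
    rw [Ne, ZMod.natCast_eq_zero_iff]
    exact Nat.not_dvd_of_pos_of_lt hne.card_pos (hlt _)
  rw [Finset.sum_add_distrib, Finset.sum_const, nsmul_eq_mul]
  field_simp

theorem le_of_isProperCol (hc : IsProperCol p n k 2 t c) : n ≤ p * (k - 1) + t * (p - 1) := by
  classical
  have : Nonempty (Fin t) := ⟨c ∅⟩
  have hp : p.Prime := Fact.out
  set α := p * (k - 1) with hα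
  have hsigns {x : ℕ → Option (ZMod p)} (h : ¬ alt n x ≤ α) :
      ∃ j, (signsOf n k c x j).Nonempty := by
    obtain ⟨a, S, hS, hx⟩ := exists_mem_V_of_lt_alt (not_le.1 h)
    exact ⟨c S, a, mem_signsOf.2 ⟨S, hS, rfl, hx⟩⟩
  have hpos {x : ℕ → Option (ZMod p)} (h : ¬ alt n x ≤ α) :
      0 < ∑ j, (signsOf n k c x j).card := by
    obtain ⟨j, hj⟩ := hsigns h
    exact Finset.sum_pos' (fun _ _ => Nat.zero_le _) ⟨j, Finset.mem_univ _, hj.card_pos⟩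
  refine le_of_equivariant_labelling hp.one_lt
    (s := fun x => if alt n x ≤ α then firstSign x else meanSign (signsOf n k c x))
    (r := fun x => if alt n x ≤ α then alt n x else α + ∑ j, (signsOf n k c x j).card)
    (fun x hx g => ?_) (fun x hx => ?_) (fun x y _ _ hxy => ?_) (fun x y hx hy hxy => ?_)
  · simp only [alt_vadd]
    split_ifs with h
    · exact hx.firstSign_vadd g
    · rw [show signsOf n k c (g +ᵥ x) = _ from funext fun j => signsOf_vadd x j g]
      exact meanSign_map (hsigns h) (card_signsOf_lt hc x) g
  · rw [Finset.mem_Icc]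
    split_ifs with h
    · exact ⟨hx.alt_pos, by lia⟩
    · have hle : ∑ j, (signsOf n k c x j).card ≤ ∑ _j : Fin t, (p - 1) :=
        Finset.sum_le_sum fun j _ => Nat.le_sub_one_of_lt (card_signsOf_lt hc x j)
      rw [Finset.sum_const, Finset.card_univ, Fintype.card_fin, smul_eq_mul] at hle
      have := hpos h
      lia
  · have := alt_mono (n := n) hxy
    split_ifs with h h' h'
    · exact this
    · lia
    · lia
    · exact Nat.add_le_add_left
        (Finset.sum_le_sum fun j _ => Finset.card_le_card (signsOf_mono hxy j)) _
  · have := alt_mono (n := n) hxy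
    split_ifs with h h' h' <;> intro heq
    · exact firstSign_eq_of_alt_eq hx hy hxy heq
    · have := hpos h'
      lia
    · lia
    · have hcard := (Finset.sum_eq_sum_iff_of_le fun j _ =>
        Finset.card_le_card (signsOf_mono (c := c) (n := n) (k := k) hxy j)).1
          (Nat.add_left_cancel heq)
      exact congrArg meanSign (funext fun j => Finset.eq_of_subset_of_card_le
        (signsOf_mono hxy j) (hcard j (Finset.mem_univ _)).ge)

end Coloring

/-- For `p` prime and `n ≥ pk`, every proper coloring of
`KG^p([n] choose k)~_{2-stab}` uses at least `⌈(n-(k-1)p)/(p-1)⌉` colors. -/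
theorem stmt_8 (p n k : ℕ) (hp : p.Prime) (hn : p * k ≤ n) :
    ∀ t : ℕ, (∃ c : Finset ℕ → Fin t, IsProperCol p n k 2 t c) →
      ⌈((n : ℚ) - ((k : ℚ) - 1) * p) / ((p : ℚ) - 1)⌉ ≤ (t : ℤ) := by
  rintro t ⟨c, hc⟩
  have : Fact p.Prime := ⟨hp⟩
  have hp1 : (0 : ℚ) < (p : ℚ) - 1 := sub_pos.2 (by exact_mod_cast hp.one_lt)
  obtain rfl | hk := k.eq_zero_or_pos
  · obtain ⟨i, j, hij⟩ := hc (fun _ => ∅) (fun _ => by simp [V, stab]) (by simp)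
    exact absurd rfl hij
  have h := le_of_isProperCol hc
  have hq : (n : ℚ) ≤ p * (k - 1) + t * (p - 1) := by
    rw [← Nat.cast_one, ← Nat.cast_sub hk, ← Nat.cast_sub hp.one_lt.le]
    exact_mod_cast h
  rw [Int.ceil_le, div_le_iff₀ hp1, Int.cast_natCast]
  linarith
end

section
/- (Alon–Frankl–Lovász lower bound, stated) For positive integers n, k, r, t with n ≥ (t-1)(r-1) + rk, the chromatic number of KG^r([n] choose k) is greater than t. -/
/-- `c` is a proper coloring of the Kneser hypergraph `KG^r([n] choose k)`. -/
def IsProperColKneser (r n k t : ℕ) (c : Finset ℕ → Fin t) : Prop :=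
  ∀ f : Fin r → Finset ℕ, (∀ i, f i ⊆ Finset.Icc 1 n ∧ (f i).card = k) →
    (∀ i j, i ≠ j → Disjoint (f i) (f j)) → ∃ i j, c (f i) ≠ c (f j)

namespace KneserHypergraph

open Finset

section Coboundary

variable {V W R : Type*} [CommRing R]

/-- The coboundary of a cochain on ordered simplices (lists of vertices), in the augmented
complex: the alternating sum of the values on the faces. -/
def coboundary : (List V → R) → List V → R
  | _, [] => 0
  | Φ, v :: l => Φ l - coboundary (fun m => Φ (v :: m)) l

theorem coboundary_sub (Φ Ψ : List V → R) (l : List V) :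
    coboundary (fun m => Φ m - Ψ m) l = coboundary Φ l - coboundary Ψ l := by
  induction l generalizing Φ Ψ with
  | nil => simp [coboundary]
  | cons v l ih => simp only [coboundary, ih]; ring

theorem coboundary_eq_zero {Φ : List V → R} {l : List V}
    (h : ∀ m, m.Sublist l → m.length + 1 = l.length → Φ m = 0) : coboundary Φ l = 0 := by
  induction l generalizing Φ with
  | nil => rfl
  | cons v l ih =>
    rw [coboundary, h l (List.sublist_cons_self v l) rfl, ih, sub_zero]
    exact fun m hm hl => h _ (hm.cons_cons v) (by simpa using hl)

theorem coboundary_congr {Φ Ψ : List V → R} {l : List V}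
    (h : ∀ m, m.length + 1 = l.length → Φ m = Ψ m) : coboundary Φ l = coboundary Ψ l := by
  rw [← sub_eq_zero, ← coboundary_sub]
  exact coboundary_eq_zero fun m _ hm => sub_eq_zero.2 (h m hm)

theorem coboundary_sum {ι : Type*} (s : Finset ι) (Φ : ι → List V → R) (l : List V) :
    coboundary (fun m => ∑ i ∈ s, Φ i m) l = ∑ i ∈ s, coboundary (Φ i) l := by
  induction l generalizing Φ with
  | nil => simp [coboundary]
  | cons v l ih => simp only [coboundary, ih, Finset.sum_sub_distrib]

theorem coboundary_coboundary (Φ : List V → R) (l : List V) :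
    coboundary (coboundary Φ) l = 0 := by
  induction l generalizing Φ with
  | nil => rfl
  | cons v l ih => simp only [coboundary, coboundary_sub, ih]; ring

theorem coboundary_map (s : V → W) (Φ : List W → R) (l : List V) :
    coboundary Φ (l.map s) = coboundary (fun m => Φ (m.map s)) l := by
  induction l generalizing Φ with
  | nil => rfl
  | cons v l ih => simp only [List.map_cons, coboundary, ih]

/-- A cochain is normalized if it vanishes on lists with two equal adjacent entries. -/
def IsNormalized (Φ : List V → R) : Prop :=
  ∀ l₁ a l₂, Φ (l₁ ++ a :: a :: l₂) = 0

theorem IsNormalized.cons {Φ : List V → R} (h : IsNormalized Φ) (v : V) :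
    IsNormalized fun m => Φ (v :: m) :=
  fun l₁ => h (v :: l₁)

theorem IsNormalized.coboundary {Φ : List V → R} (h : IsNormalized Φ) :
    IsNormalized (coboundary Φ) := by
  intro l₁ a l₂
  induction l₁ generalizing Φ with
  | nil =>
    have h0 : KneserHypergraph.coboundary (fun m => Φ (a :: a :: m)) l₂ = 0 :=
      coboundary_eq_zero fun m _ _ => h [] a m
    simp [KneserHypergraph.coboundary, h0]
  | cons v l₁ ih =>
    rw [List.cons_append, KneserHypergraph.coboundary, h, ih (h.cons v), sub_zero]

/-- The pullback of cochains along the chain map from the subdivision operator followed by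
a labelling `Q` of simplices; it is meaningful on lists of length `k`. -/
def pullback (Q : List V → W) : ℕ → (List W → R) → List V → R
  | 0, Φ, _ => Φ []
  | k + 1, Φ, l => coboundary (pullback Q k fun m => Φ (Q l :: m)) l

theorem pullback_sub (Q : List V → W) (k : ℕ) (Φ Ψ : List W → R) (l : List V) :
    pullback Q k (fun m => Φ m - Ψ m) l = pullback Q k Φ l - pullback Q k Ψ l := by
  induction k generalizing Φ Ψ l with
  | zero => rfl
  | succ k ih => simp only [pullback, ← coboundary_sub, ← ih]

theorem pullback_sum (Q : List V → W) (k : ℕ) {ι : Type*} (s : Finset ι) (Φ : ι → List W → R)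
    (l : List V) :
    pullback Q k (fun m => ∑ i ∈ s, Φ i m) l = ∑ i ∈ s, pullback Q k (Φ i) l := by
  induction k generalizing Φ l with
  | zero => rfl
  | succ k ih => simp only [pullback, ← coboundary_sum, ← ih]

theorem pullback_zero (Q : List V → W) (k : ℕ) (l : List V) :
    pullback Q k (fun _ => (0 : R)) l = 0 := by
  simpa using pullback_sum Q k (∅ : Finset ℕ) (fun _ _ => (0 : R)) l

theorem pullback_coboundary (Q : List V → W) (k : ℕ) (Φ : List W → R) (l : List V)
    (hl : l.length = k + 1) :
    pullback Q (k + 1) (coboundary Φ) l = coboundary (pullback Q k Φ) l := by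
  induction k generalizing Φ l with
  | zero =>
    obtain ⟨v, rfl⟩ := List.length_eq_one_iff.1 hl
    simp [pullback, coboundary]
  | succ k ih =>
    have h : coboundary (pullback Q (k + 1) (coboundary fun m => Φ (Q l :: m))) l = 0 := by
      rw [coboundary_congr fun m hm => ih _ m (by omega), coboundary_coboundary]
    rw [pullback]
    simp only [coboundary]
    rw [coboundary_congr fun m _ => pullback_sub Q (k + 1) Φ _ m, coboundary_sub, h, sub_zero]

end Coboundary

section Twist

variable {p : ℕ} {V W R : Type*} [CommRing R] [AddAction (ZMod p) V] [AddAction (ZMod p) W]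

/-- The translate of an ordered simplex by a group element. -/
def shift (g : ZMod p) (l : List V) : List V := l.map (g +ᵥ ·)

@[simp]
theorem shift_nil (g : ZMod p) : shift g ([] : List V) = [] := rfl

@[simp]
theorem shift_cons (g : ZMod p) (v : V) (l : List V) :
    shift g (v :: l) = (g +ᵥ v) :: shift g l := rfl

@[simp]
theorem shift_append (g : ZMod p) (l m : List V) :
    shift g (l ++ m) = shift g l ++ shift g m := List.map_append

@[simp]
theorem length_shift (g : ZMod p) (l : List V) : (shift g l).length = l.length :=
  List.length_map _

theorem shift_shift (g h : ZMod p) (l : List V) : shift g (shift h l) = shift (g + h) l := by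
  simp [shift, add_vadd]

@[simp]
theorem shift_zero (l : List V) : shift (0 : ZMod p) l = l := by
  simp [shift]

theorem coboundary_shift (g : ZMod p) (Φ : List V → R) (l : List V) :
    coboundary Φ (shift g l) = coboundary (fun m => Φ (shift g m)) l :=
  coboundary_map _ Φ l

variable (p) in
/-- The action of `1 - g`, up to sign, on cochains. -/
def diff (Φ : List V → R) (l : List V) : R :=
  Φ (shift (1 : ZMod p) l) - Φ l

theorem diff_coboundary (Φ : List V → R) (l : List V) :
    diff p (coboundary Φ) l = coboundary (diff p Φ) l := by
  unfold diff
  rw [coboundary_sub, coboundary_shift]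

theorem apply_shift_of_diff_eq_zero [NeZero p] {Φ : List V → R} (h : ∀ l, diff p Φ l = 0)
    (g : ZMod p) (l : List V) : Φ (shift g l) = Φ l := by
  have key : ∀ n : ℕ, Φ (shift (n : ZMod p) l) = Φ l := by
    intro n
    induction n with
    | zero => simp
    | succ n ih =>
      have := h (shift (n : ZMod p) l)
      rw [diff, shift_shift, sub_eq_zero, ih] at this
      rwa [Nat.cast_succ, add_comm]
  simpa using key g.val

variable [NeZero p]

variable (p) in
/-- The action of the norm element on cochains. -/
def normSum (Φ : List V → R) (l : List V) : R :=
  ∑ g : ZMod p, Φ (shift g l)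

theorem normSum_coboundary (Φ : List V → R) (l : List V) :
    normSum p (coboundary Φ) l = coboundary (normSum p Φ) l := by
  unfold normSum
  rw [coboundary_sum]
  simp only [coboundary_shift]

theorem normSum_diff (Φ : List V → R) (l : List V) : normSum p (diff p Φ) l = 0 := by
  simp only [normSum, diff, Finset.sum_sub_distrib, sub_eq_zero, shift_shift]
  exact Fintype.sum_equiv (Equiv.addLeft 1) _ _ fun _ => rfl

theorem diff_normSum (Φ : List V → R) (l : List V) : diff p (normSum p Φ) l = 0 := by
  simp only [normSum, diff, sub_eq_zero, shift_shift]
  exact Fintype.sum_equiv (Equiv.addRight 1) _ _ fun _ => rfl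

variable (p) in
/-- The differentials of the periodic resolution of the cyclic group, acting on cochains. -/
def twist (k : ℕ) (Φ : List V → R) : List V → R :=
  if k = 0 then Φ else if Even k then diff p Φ else normSum p Φ

theorem twist_sub (k : ℕ) (Φ Ψ : List V → R) (l : List V) :
    twist p k (fun m => Φ m - Ψ m) l = twist p k Φ l - twist p k Ψ l := by
  unfold twist
  split_ifs
  · rfl
  · simp only [diff]; ring
  · simp only [normSum, Finset.sum_sub_distrib]

theorem twist_congr {k : ℕ} {Φ Ψ : List V → R} {l : List V}
    (h : ∀ g : ZMod p, Φ (shift g l) = Ψ (shift g l)) : twist p k Φ l = twist p k Ψ l := by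
  have h0 := h 0
  rw [shift_zero] at h0
  unfold twist
  split_ifs
  · exact h0
  · simp only [diff, h, h0]
  · simp only [normSum, h]

theorem twist_coboundary (k : ℕ) (Φ : List V → R) (l : List V) :
    twist p k (coboundary Φ) l = coboundary (twist p k Φ) l := by
  unfold twist
  split_ifs
  · rfl
  · exact diff_coboundary Φ l
  · exact normSum_coboundary Φ l

theorem twist_twist {k : ℕ} (hk : k ≠ 0) (Φ : List V → R) (l : List V) :
    twist p k (twist p (k + 1) Φ) l = 0 := by
  by_cases h : Even k
  · simpa [twist, hk, h, Nat.even_add_one] using diff_normSum Φ l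
  · simpa [twist, hk, h, Nat.even_add_one] using normSum_diff Φ l

omit [NeZero p] in
theorem pullback_shift {Q : List V → W}
    (hQ : ∀ (g : ZMod p) (l : List V), l ≠ [] → Q (shift g l) = g +ᵥ Q l) (g : ZMod p) (k : ℕ)
    (Φ : List W → R) (l : List V) (hl : l.length = k) :
    pullback Q k Φ (shift g l) = pullback Q k (fun m => Φ (shift g m)) l := by
  induction k generalizing Φ l with
  | zero => rfl
  | succ k ih =>
    rw [pullback, coboundary_shift, pullback, hQ g l (by rintro rfl; simp at hl)]
    exact coboundary_congr fun m hm => ih _ m (by omega)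

theorem twist_pullback {Q : List V → W}
    (hQ : ∀ (g : ZMod p) (l : List V), l ≠ [] → Q (shift g l) = g +ᵥ Q l) (j k : ℕ)
    (Φ : List W → R) (l : List V) (hl : l.length = k) :
    twist p j (pullback Q k Φ) l = pullback Q k (twist p j Φ) l := by
  unfold twist
  split_ifs
  · rfl
  · unfold diff
    rw [pullback_sub, pullback_shift hQ 1 k Φ l hl]
  · unfold normSum
    rw [pullback_sum]
    exact Finset.sum_congr rfl fun g _ => pullback_shift hQ g k Φ l hl

end Twist

section Cocycle

variable {p : ℕ} [NeZero p] {R : Type*} [CommRing R]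

/-- Restriction of a cochain to the simplices starting at `0`. -/
def restrictHead (Ψ : List (ZMod p) → R) : List (ZMod p) → R
  | [] => 0
  | a :: l => if a = 0 then Ψ (a :: l) else 0

theorem normSum_restrictHead {Ψ : List (ZMod p) → R} (h0 : Ψ [] = 0)
    (h : ∀ l, diff p Ψ l = 0) (l : List (ZMod p)) : normSum p (restrictHead Ψ) l = Ψ l := by
  cases l with
  | nil => simp [normSum, restrictHead, h0]
  | cons a l =>
    have h1 : ∀ g : ZMod p, restrictHead Ψ (shift g (a :: l)) =
        if g = -a then Ψ (a :: l) else 0 := by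
      intro g
      have h2 := apply_shift_of_diff_eq_zero h g (a :: l)
      rw [shift_cons, vadd_eq_add] at h2 ⊢
      simp only [restrictHead, h2, add_eq_zero_iff_eq_neg]
    rw [normSum, Finset.sum_congr rfl fun g _ => h1 g]
    simp

/-- A primitive for `diff` on cochains of norm zero. -/
def antidiff (Ψ : List (ZMod p) → R) : List (ZMod p) → R
  | [] => 0
  | a :: l => ∑ j ∈ range a.val, Ψ (shift ((j : ZMod p) - a) (a :: l))

theorem diff_antidiff {Ψ : List (ZMod p) → R} (h0 : Ψ [] = 0)
    (h : ∀ l, normSum p Ψ l = 0) (l : List (ZMod p)) : diff p (antidiff Ψ) l = Ψ l := by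
  cases l with
  | nil => simp [diff, antidiff, h0]
  | cons a l =>
    have h1 : antidiff Ψ (shift (1 : ZMod p) (a :: l)) =
        ∑ j ∈ range (1 + a).val, Ψ (shift ((j : ZMod p) - a) (a :: l)) := by
      rw [shift_cons, antidiff, vadd_eq_add]
      refine Finset.sum_congr rfl fun j _ => ?_
      rw [← vadd_eq_add, ← shift_cons, shift_shift, vadd_eq_add]
      congr 2
      ring
    have h2 : ∑ j ∈ range (a.val + 1), Ψ (shift ((j : ZMod p) - a) (a :: l)) =
        antidiff Ψ (a :: l) + Ψ (a :: l) := by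
      rw [Finset.sum_range_succ, antidiff]
      simp
    rw [diff, h1, sub_eq_iff_eq_add', ← h2]
    rcases (Nat.succ_le_of_lt a.val_lt).lt_or_eq with hlt | heq
    · rw [add_comm 1 a, ZMod.val_add_of_lt, ZMod.val_one'' (by omega)]
      rw [ZMod.val_one'' (by omega)]; exact hlt
    · have ha : (1 : ZMod p) + a = 0 := by
        have : ((a.val + 1 : ℕ) : ZMod p) = 0 := by
          rw [← Nat.succ_eq_add_one, heq, ZMod.natCast_self]
        simpa [add_comm] using this
      rw [ha, ZMod.val_zero, Finset.sum_range_zero, ← Nat.succ_eq_add_one, heq]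
      rw [← h (shift (-a) (a :: l)), normSum]
      symm
      refine Finset.sum_bij' (fun j _ => (j : ZMod p)) (fun g _ => g.val) ?_ ?_ ?_ ?_ ?_
      · simp
      · simp [ZMod.val_lt]
      · intro j hj
        exact ZMod.val_cast_of_lt (Finset.mem_range.1 hj)
      · simp
      · intro j _
        rw [shift_shift, sub_eq_add_neg]

variable (p R) in
/-- Normalized cochains on the simplex with vertex set `ZMod p` representing generators of
the cohomology of the cyclic group. -/
def cocycle : ℕ → List (ZMod p) → R
  | 0 => fun l => if l = [] then 1 else 0
  | k + 1 =>
    if Even (k + 1) then antidiff (coboundary (cocycle k))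
    else restrictHead (coboundary (cocycle k))

theorem twist_cocycle (k : ℕ) (l : List (ZMod p)) :
    twist p (k + 1) (cocycle p R (k + 1)) l = coboundary (cocycle p R k) l := by
  induction k generalizing l with
  | zero =>
    have h : ∀ l, diff p (coboundary (cocycle p R 0)) l = 0 := by
      intro l
      rw [diff_coboundary]
      refine coboundary_eq_zero fun m _ _ => ?_
      simp [diff, cocycle, shift]
    simpa [twist, cocycle] using normSum_restrictHead rfl h l
  | succ k ih =>
    have hz : ∀ l, twist p (k + 1) (coboundary (cocycle p R (k + 1))) l = 0 := by
      intro l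
      rw [twist_coboundary, coboundary_congr fun m _ => ih m, coboundary_coboundary]
    by_cases hk : Even (k + 1)
    · have hk' : ¬ Even (k + 1 + 1) := by simpa [Nat.even_add_one] using hk
      simp only [twist, if_pos hk, Nat.succ_ne_zero, if_false] at hz
      rw [twist, if_neg (Nat.succ_ne_zero _), if_neg hk', cocycle, if_neg hk']
      exact normSum_restrictHead rfl hz l
    · have hk' : Even (k + 1 + 1) := by simpa [Nat.even_add_one] using hk
      simp only [twist, if_neg hk, Nat.succ_ne_zero, if_false] at hz
      rw [twist, if_neg (Nat.succ_ne_zero _), if_pos hk', cocycle, if_pos hk']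
      exact diff_antidiff rfl hz l

omit [NeZero p] in
theorem IsNormalized.restrictHead {Ψ : List (ZMod p) → R} (h : IsNormalized Ψ) :
    IsNormalized (restrictHead Ψ) := by
  intro l₁ a l₂
  cases l₁ with
  | nil => simpa [KneserHypergraph.restrictHead] using fun _ => h [] a l₂
  | cons b l₁ => simpa [KneserHypergraph.restrictHead] using fun _ => h (b :: l₁) a l₂

omit [NeZero p] in
theorem IsNormalized.antidiff {Ψ : List (ZMod p) → R} (h : IsNormalized Ψ) :
    IsNormalized (antidiff Ψ) := by
  have h' : ∀ (g : ZMod p) l₁ a l₂, Ψ (shift g (l₁ ++ a :: a :: l₂)) = 0 := fun g l₁ a l₂ => by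
    simpa using h (shift g l₁) (g +ᵥ a) (shift g l₂)
  intro l₁ a l₂
  cases l₁ with
  | nil => exact Finset.sum_eq_zero fun j _ => h' _ [] a l₂
  | cons b l₁ => exact Finset.sum_eq_zero fun j _ => h' _ (b :: l₁) a l₂

omit [NeZero p] in
theorem isNormalized_cocycle (k : ℕ) : IsNormalized (cocycle p R k) := by
  induction k with
  | zero => intro l₁ a l₂; simp [cocycle]
  | succ k ih =>
    rw [cocycle]
    split_ifs
    · exact ih.coboundary.antidiff
    · exact ih.coboundary.restrictHead

end Cocycle

/-- A vertex of the join of copies of `ZMod p` indexed by `α`. -/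
@[ext]
structure SignedPoint (α : Type*) (p : ℕ) where
  /-- the copy of `ZMod p` containing the vertex -/
  coord : α
  /-- the position inside the copy -/
  sign : ZMod p

section Join

variable {p : ℕ} {α R : Type*} [CommRing R]

instance : AddAction (ZMod p) (SignedPoint α p) where
  vadd g v := ⟨v.coord, g + v.sign⟩
  zero_vadd _ := SignedPoint.ext rfl (zero_add _)
  add_vadd _ _ _ := SignedPoint.ext rfl (add_assoc _ _ _)

@[simp]
theorem coord_vadd (g : ZMod p) (v : SignedPoint α p) : (g +ᵥ v).coord = v.coord := rfl

@[simp]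
theorem sign_vadd (g : ZMod p) (v : SignedPoint α p) : (g +ᵥ v).sign = g + v.sign := rfl

@[simp]
theorem map_coord_shift (g : ZMod p) (l : List (SignedPoint α p)) :
    (shift g l).map SignedPoint.coord = l.map SignedPoint.coord := by
  simp [shift]

/-- Evaluation of a cochain on a chain in the join whose boundary is prescribed by the
periodic resolution. -/
def evalJoin [NeZero p] : List α → (List (SignedPoint α p) → R) → R
  | [], Φ => Φ []
  | i :: L, Φ => evalJoin L (twist p L.length fun m => Φ (⟨i, 0⟩ :: m))

variable [NeZero p]

theorem evalJoin_congr {L : List α} {Φ Ψ : List (SignedPoint α p) → R}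
    (h : ∀ m, m.map SignedPoint.coord = L → Φ m = Ψ m) : evalJoin L Φ = evalJoin L Ψ := by
  induction L generalizing Φ Ψ with
  | nil => exact h [] rfl
  | cons i L ih =>
    exact ih fun m hm => twist_congr fun g => h _ (by simp [hm])

theorem evalJoin_sub (L : List α) (Φ Ψ : List (SignedPoint α p) → R) :
    evalJoin L (fun m => Φ m - Ψ m) = evalJoin L Φ - evalJoin L Ψ := by
  induction L generalizing Φ Ψ with
  | nil => rfl
  | cons i L ih =>
    simp only [evalJoin, ← ih]
    exact evalJoin_congr fun m _ => twist_sub _ _ _ m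

theorem evalJoin_zero (L : List α) :
    evalJoin L (fun _ : List (SignedPoint α p) => (0 : R)) = 0 := by
  simpa using evalJoin_sub L (fun _ : List (SignedPoint α p) => (0 : R)) fun _ => 0

theorem evalJoin_coboundary [CharP R p] (i : α) (L : List α)
    (Φ : List (SignedPoint α p) → R) :
    evalJoin (i :: L) (coboundary Φ) = evalJoin L (twist p L.length Φ) := by
  induction L generalizing i Φ with
  | nil => simp [evalJoin, twist, coboundary]
  | cons j L ih =>
    rw [evalJoin]
    simp only [coboundary]
    rw [evalJoin_congr fun m _ => twist_sub _ Φ _ m, evalJoin_sub,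
      evalJoin_congr fun m _ => twist_coboundary _ (fun m => Φ (⟨i, 0⟩ :: m)) m, ih]
    suffices h : evalJoin L (twist p L.length
        (twist p (L.length + 1) fun m => Φ (⟨i, 0⟩ :: m))) = 0 by
      rw [List.length_cons, h, sub_zero]
    cases L with
    | nil => simp [evalJoin, twist, normSum]
    | cons _ L =>
      exact (evalJoin_congr fun m _ => twist_twist (Nat.succ_ne_zero _) _ m).trans
        (evalJoin_zero _)

theorem evalJoin_pullback_cocycle [CharP R p] {Q : List (SignedPoint α p) → ZMod p}
    (hQ : ∀ (g : ZMod p) (l : List (SignedPoint α p)), l ≠ [] → Q (shift g l) = g +ᵥ Q l)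
    (L : List α) :
    evalJoin L (twist p L.length (pullback Q L.length (cocycle p R L.length))) = 1 := by
  induction L with
  | nil => simp [evalJoin, twist, pullback, cocycle]
  | cons i L ih =>
    rw [← ih, ← evalJoin_coboundary i L]
    refine evalJoin_congr fun m hm => ?_
    have hl : m.length = L.length + 1 := by simpa using congrArg List.length hm
    rw [List.length_cons, twist_pullback hQ _ _ _ _ hl, funext (twist_cocycle L.length),
      pullback_coboundary _ _ _ _ hl]

end Join

section Rank

variable {V W R : Type*} [CommRing R]

/-- If along inclusions of simplices the label changes only when the rank does, then
normalized cochains pull back to zero on simplices of small rank. -/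
theorem pullback_eq_zero_of_rank_lt {Q : List V → W} {ρ : List V → ℕ} {A : List V → Prop}
    (hA : ∀ l m, A l → m.Sublist l → A m)
    (hpos : ∀ l, A l → l ≠ [] → 1 ≤ ρ l)
    (hmono : ∀ l m, A l → m.Sublist l → m ≠ [] → ρ m ≤ ρ l ∧ (ρ m = ρ l → Q m = Q l))
    (k : ℕ) {Φ : List W → R} (hΦ : IsNormalized Φ) {l : List V} (hl : l.length = k)
    (hAl : A l) (hρ : ρ l < k) : pullback Q k Φ l = 0 := by
  induction k generalizing Φ l with
  | zero => omega
  | succ k ih =>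
    refine coboundary_eq_zero fun m hm hml => ?_
    have hAm := hA l m hAl hm
    rcases lt_or_ge (ρ m) k with h | h
    · exact ih (hΦ.cons _) (by omega) hAm h
    · cases k with
      | zero =>
        have := hpos l hAl (by rintro rfl; simp at hl)
        omega
      | succ k =>
        obtain ⟨h1, h2⟩ := hmono l m hAl hm (by rintro rfl; simp at hml; omega)
        have h0 : (fun n => Φ (Q l :: Q m :: n)) = fun _ => 0 := by
          rw [h2 (by omega)]
          exact funext fun n => hΦ [] _ n
        rw [pullback, h0]
        exact coboundary_eq_zero fun n _ _ => pullback_zero Q k n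

end Rank

/-- A `ZMod p`-Tucker lemma: an equivariant labelling of the simplices of the `n`-fold join of
`ZMod p` whose label changes along inclusions only together with a monotone rank must
use a rank of at least `n`. -/
theorem exists_length_le_rank {p : ℕ} [Fact p.Prime] {α : Type*}
    {Q : List (SignedPoint α p) → ZMod p} {ρ : List (SignedPoint α p) → ℕ} (L : List α)
    (hQ : ∀ (g : ZMod p) (l : List (SignedPoint α p)), l ≠ [] → Q (shift g l) = g + Q l)
    (hpos : ∀ l, (l.map SignedPoint.coord).Sublist L → l ≠ [] → 1 ≤ ρ l)
    (hmono : ∀ l m, (l.map SignedPoint.coord).Sublist L → m.Sublist l → m ≠ [] →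
      ρ m ≤ ρ l ∧ (ρ m = ρ l → Q m = Q l)) :
    ∃ l, l.map SignedPoint.coord = L ∧ L.length ≤ ρ l := by
  by_contra! hlt
  have h1 := evalJoin_pullback_cocycle (R := ZMod p) hQ L
  rw [evalJoin_congr (Ψ := fun _ => 0), evalJoin_zero] at h1
  · exact zero_ne_one h1
  · intro m hm
    rw [twist_congr (Ψ := fun _ => (0 : ZMod p))]
    · unfold twist
      split_ifs <;> simp [diff, normSum]
    · intro g
      have hg : (shift g m).map SignedPoint.coord = L := by simpa using hm
      exact pullback_eq_zero_of_rank_lt (A := fun l => (l.map SignedPoint.coord).Sublist L)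
        (fun l n hl hn => (hn.map _).trans hl) hpos hmono _ (isNormalized_cocycle _)
        (by simpa using congrArg List.length hg) (by rw [hg]) (hlt _ hg)

section ColorPattern

variable {p t : ℕ}

/-- The coordinates which occur in `l` with the sign `g`. -/
def signedPart (l : List (SignedPoint ℕ p)) (g : ZMod p) : Finset ℕ :=
  ((l.filter fun v => v.sign = g).map SignedPoint.coord).toFinset

theorem mem_signedPart {l : List (SignedPoint ℕ p)} {g : ZMod p} {i : ℕ} :
    i ∈ signedPart l g ↔ ⟨i, g⟩ ∈ l := by
  simp only [signedPart, List.mem_toFinset, List.mem_map, List.mem_filter, decide_eq_true_eq]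
  constructor
  · rintro ⟨v, ⟨hv, rfl⟩, rfl⟩
    exact hv
  · exact fun h => ⟨_, ⟨h, rfl⟩, rfl⟩

theorem signedPart_shift (g h : ZMod p) (l : List (SignedPoint ℕ p)) :
    signedPart (shift g l) h = signedPart l (h - g) := by
  ext i
  simp only [mem_signedPart, shift, List.mem_map]
  constructor
  · rintro ⟨v, hv, hvi⟩
    have h1 : i = v.coord := (congrArg SignedPoint.coord hvi).symm
    have h2 : h = g + v.sign := (congrArg SignedPoint.sign hvi).symm
    simpa [h1, h2] using hv
  · exact fun hv => ⟨_, hv, SignedPoint.ext rfl (by simp)⟩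

theorem disjoint_signedPart {l : List (SignedPoint ℕ p)}
    (hl : (l.map SignedPoint.coord).Nodup) {g h : ZMod p} (hgh : g ≠ h) :
    Disjoint (signedPart l g) (signedPart l h) := by
  rw [Finset.disjoint_left]
  intro i hg hh
  rw [mem_signedPart] at hg hh
  exact hgh (congrArg SignedPoint.sign (List.inj_on_of_nodup_map hl hg hh rfl))

variable [NeZero p]

open Classical in
/-- The pairs of a sign and a color such that some `k`-set of that color is contained in the
part of `l` with that sign. -/
noncomputable def colorPattern (k : ℕ) (c : Finset ℕ → Fin t) (l : List (SignedPoint ℕ p)) :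
    Finset (ZMod p × Fin t) :=
  univ.filter fun a => ∃ F ⊆ signedPart l a.1, #F = k ∧ c F = a.2

theorem mem_colorPattern {k : ℕ} {c : Finset ℕ → Fin t} {l : List (SignedPoint ℕ p)}
    {a : ZMod p × Fin t} :
    a ∈ colorPattern k c l ↔ ∃ F ⊆ signedPart l a.1, #F = k ∧ c F = a.2 := by
  simp [colorPattern]

theorem colorPattern_mono (k : ℕ) (c : Finset ℕ → Fin t) {l m : List (SignedPoint ℕ p)}
    (h : m.Sublist l) : colorPattern k c m ⊆ colorPattern k c l := by
  intro a ha
  rw [mem_colorPattern] at ha ⊢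
  obtain ⟨F, hF, hF'⟩ := ha
  exact ⟨F, fun i hi => mem_signedPart.2 (h.subset (mem_signedPart.1 (hF hi))), hF'⟩

theorem colorPattern_shift (k : ℕ) (c : Finset ℕ → Fin t) (g : ZMod p)
    (l : List (SignedPoint ℕ p)) :
    colorPattern k c (shift g l) =
      (colorPattern k c l).map ((Equiv.addLeft g).prodCongr (Equiv.refl _)).toEmbedding := by
  ext a
  simp only [Finset.mem_map_equiv, mem_colorPattern, signedPart_shift]
  simp [sub_eq_neg_add]

theorem length_le_of_colorPattern_eq_empty {k : ℕ} (hk : 1 ≤ k) {c : Finset ℕ → Fin t}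
    {l : List (SignedPoint ℕ p)} (hl : (l.map SignedPoint.coord).Nodup)
    (h : colorPattern k c l = ∅) : l.length ≤ p * (k - 1) := by
  have h1 : (l.map SignedPoint.coord).toFinset ⊆ univ.biUnion (signedPart l) := by
    intro i hi
    obtain ⟨v, hv, rfl⟩ := List.mem_map.1 (List.mem_toFinset.1 hi)
    exact Finset.mem_biUnion.2 ⟨v.sign, Finset.mem_univ _, mem_signedPart.2 hv⟩
  have h2 : ∀ g ∈ (univ : Finset (ZMod p)), #(signedPart l g) ≤ k - 1 := by
    intro g _
    by_contra! hlt
    obtain ⟨F, hF, hFk⟩ := Finset.exists_subset_card_eq (show k ≤ #(signedPart l g) by omega)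
    have : (g, c F) ∈ colorPattern k c l := mem_colorPattern.2 ⟨F, hF, hFk, rfl⟩
    simp [h] at this
  calc l.length = #(l.map SignedPoint.coord).toFinset := by
        rw [List.toFinset_card_of_nodup hl, List.length_map]
    _ ≤ #(univ.biUnion (signedPart l)) := Finset.card_le_card h1
    _ ≤ #(univ : Finset (ZMod p)) * (k - 1) := Finset.card_biUnion_le_card_mul _ _ _ h2
    _ = p * (k - 1) := by rw [Finset.card_univ, ZMod.card]

/-- The part of a set of colored signs which has the smallest color. -/
def leastSlice (S : Finset (ZMod p × Fin t)) : Finset (ZMod p × Fin t) :=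
  S.filter fun a => (a.2 : WithTop (Fin t)) = (S.image Prod.snd).min

/-- The average sign in the least slice. -/
def barycenter (S : Finset (ZMod p × Fin t)) : ZMod p :=
  (∑ a ∈ leastSlice S, a.1) * (#(leastSlice S) : ZMod p)⁻¹

omit [NeZero p] in
theorem barycenter_map [Fact p.Prime] {S : Finset (ZMod p × Fin t)} (hS : S.Nonempty)
    (h : ∀ b, #{a ∈ S | a.2 = b} < p) (g : ZMod p) :
    barycenter (S.map ((Equiv.addLeft g).prodCongr (Equiv.refl _)).toEmbedding) =
      g + barycenter S := by
  have h1 : leastSlice (S.map ((Equiv.addLeft g).prodCongr (Equiv.refl _)).toEmbedding) =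
      (leastSlice S).map ((Equiv.addLeft g).prodCongr (Equiv.refl _)).toEmbedding := by
    have : (S.map ((Equiv.addLeft g).prodCongr (Equiv.refl (Fin t))).toEmbedding).image
        Prod.snd = S.image Prod.snd := by
      rw [Finset.map_eq_image, Finset.image_image]
      rfl
    rw [leastSlice, this, Finset.filter_map]
    rfl
  have h2 : ((#(leastSlice S) : ℕ) : ZMod p) ≠ 0 := by
    obtain ⟨b, hb⟩ := Finset.min_of_nonempty (hS.image Prod.snd)
    have h3 : leastSlice S = {a ∈ S | a.2 = b} := by
      simp only [leastSlice, hb, WithTop.coe_inj]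
    rw [Ne, ZMod.natCast_eq_zero_iff, h3]
    refine Nat.not_dvd_of_pos_of_lt (Finset.card_pos.2 ?_) (h b)
    obtain ⟨a, ha, hab⟩ := Finset.mem_image.1 (Finset.mem_of_min hb)
    exact ⟨a, Finset.mem_filter.2 ⟨ha, hab⟩⟩
  rw [barycenter, h1, Finset.sum_map, Finset.card_map, barycenter]
  have h3 : ∑ a ∈ leastSlice S,
      (((Equiv.addLeft g).prodCongr (Equiv.refl (Fin t))).toEmbedding a).1 =
      #(leastSlice S) * g + ∑ a ∈ leastSlice S, a.1 := by
    simp [Finset.sum_add_distrib]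
  rw [h3, add_mul, mul_right_comm, mul_inv_cancel₀ h2, one_mul]

end ColorPattern

/-- Every coloring of the `k`-subsets of a large set with `t` colors has a monochromatic edge of
the `r`-uniform Kneser hypergraph. -/
def HasMonochromaticEdge (r : ℕ) : Prop :=
  ∀ (k t : ℕ) (T : Finset ℕ) (c : Finset ℕ → Fin t), 1 ≤ k →
    (t - 1) * (r - 1) + r * k ≤ #T →
    ∃ f : Fin r → Finset ℕ, (∀ i, f i ⊆ T ∧ #(f i) = k) ∧
      (∀ i j, i ≠ j → Disjoint (f i) (f j)) ∧ ∃ b, ∀ i, c (f i) = b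

theorem hasMonochromaticEdge_of_prime {p : ℕ} (hp : p.Prime) : HasMonochromaticEdge p := by
  classical
  intro k t T c hk hT
  have : Fact p.Prime := ⟨hp⟩
  by_contra hno
  let A : List (SignedPoint ℕ p) → Prop := fun l => (l.map SignedPoint.coord).Sublist T.toList
  let S : List (SignedPoint ℕ p) → Finset (ZMod p × Fin t) := colorPattern k c
  have hnodup : ∀ l, A l → (l.map SignedPoint.coord).Nodup := fun l hl =>
    T.nodup_toList.sublist hl
  have hslice : ∀ l, A l → ∀ b, #{a ∈ S l | a.2 = b} ≤ p - 1 := by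
    intro l hl b
    obtain ⟨g, hg⟩ : ∃ g, (g, b) ∉ S l := by
      by_contra! hall
      choose F hF using fun g => mem_colorPattern.1 (hall g)
      let e : Fin p ≃ ZMod p := (Fintype.equivFinOfCardEq (ZMod.card p)).symm
      refine hno ⟨fun i => F (e i), fun i => ⟨fun x hx => ?_, (hF (e i)).2.1⟩,
        fun i j hij => ?_, b, fun i => (hF (e i)).2.2⟩
      · have hx' := mem_signedPart.1 ((hF (e i)).1 hx)
        exact Finset.mem_toList.1 (hl.subset (List.mem_map.2 ⟨_, hx', rfl⟩))
      · exact (disjoint_signedPart (hnodup l hl) (e.injective.ne hij)).mono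
          (hF (e i)).1 (hF (e j)).1
    have hsub : {a ∈ S l | a.2 = b} ⊆ (univ.erase g).image fun h => (h, b) := by
      rintro ⟨h, b'⟩ ha
      obtain rfl : b' = b := (Finset.mem_filter.1 ha).2
      refine Finset.mem_image.2 ⟨h, Finset.mem_erase.2 ⟨?_, Finset.mem_univ _⟩, rfl⟩
      rintro rfl
      exact hg (Finset.mem_filter.1 ha).1
    refine (Finset.card_le_card hsub).trans (Finset.card_image_le.trans ?_)
    rw [Finset.card_erase_of_mem (Finset.mem_univ _), Finset.card_univ, ZMod.card]
  let Q : List (SignedPoint ℕ p) → ZMod p := fun l =>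
    if (S l).Nonempty ∧ A l then barycenter (S l) else (l.head?.map SignedPoint.sign).getD 0
  let ρ : List (SignedPoint ℕ p) → ℕ := fun l =>
    if (S l).Nonempty then p * (k - 1) + #(S l) else l.length
  have hρ : ∀ l, A l → ρ l ≤ p * (k - 1) + (p - 1) * t := by
    intro l hl
    by_cases hS : (S l).Nonempty
    · simp only [ρ, if_pos hS]
      refine Nat.add_le_add_left ((Finset.card_le_mul_card_image (f := Prod.snd) (S l) (p - 1)
        fun b _ => hslice l hl b).trans (Nat.mul_le_mul_left _ ?_)) _
      simpa using Finset.card_le_univ ((S l).image Prod.snd)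
    · simp only [ρ, if_neg hS]
      exact (length_le_of_colorPattern_eq_empty hk (hnodup l hl)
        (Finset.not_nonempty_iff_eq_empty.1 hS)).trans (Nat.le_add_right _ _)
  have hQ : ∀ (g : ZMod p) l, l ≠ [] → Q (shift g l) = g + Q l := by
    intro g l hne
    have hS : S (shift g l) = _ := colorPattern_shift k c g l
    have hA : A (shift g l) ↔ A l := by simp only [A, map_coord_shift]
    by_cases h : (S l).Nonempty ∧ A l
    · have h' : (S (shift g l)).Nonempty ∧ A (shift g l) := by
        rw [hS, Finset.map_nonempty, hA]; exact h
      simp only [Q, if_pos h, if_pos h']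
      rw [hS]
      exact barycenter_map h.1
        (fun b => (hslice l h.2 b).trans_lt (Nat.sub_lt hp.pos one_pos)) g
    · have h' : ¬ ((S (shift g l)).Nonempty ∧ A (shift g l)) := by
        rw [hS, Finset.map_nonempty, hA]; exact h
      simp only [Q, if_neg h, if_neg h']
      cases l with
      | nil => exact absurd rfl hne
      | cons v l => simp
  have hpos : ∀ l, A l → l ≠ [] → 1 ≤ ρ l := by
    intro l _ hne
    by_cases hS : (S l).Nonempty
    · simp only [ρ, if_pos hS]
      have := hS.card_pos
      omega
    · simp only [ρ, if_neg hS]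
      exact List.length_pos_iff.2 hne
  have hmono : ∀ l m, A l → m.Sublist l → m ≠ [] →
      ρ m ≤ ρ l ∧ (ρ m = ρ l → Q m = Q l) := by
    intro l m hl hm _
    have hAm : A m := (hm.map _).trans hl
    have hsub : S m ⊆ S l := colorPattern_mono k c hm
    by_cases hSm : (S m).Nonempty
    · have hSl := hSm.mono hsub
      simp only [ρ, if_pos hSm, if_pos hSl]
      refine ⟨Nat.add_le_add_left (Finset.card_le_card hsub) _, fun h => ?_⟩
      have hSS : S m = S l := Finset.eq_of_subset_of_card_le hsub (by omega)
      simp only [Q, if_pos (And.intro hSm hAm), if_pos (And.intro hSl hl), hSS]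
    · have hlen := length_le_of_colorPattern_eq_empty hk (hnodup m hAm)
        (Finset.not_nonempty_iff_eq_empty.1 hSm)
      by_cases hSl : (S l).Nonempty
      · have := hSl.card_pos
        simp only [ρ, if_neg hSm, if_pos hSl]
        exact ⟨by omega, fun h => by omega⟩
      · simp only [ρ, if_neg hSm, if_neg hSl]
        exact ⟨hm.length_le, fun h => by rw [hm.eq_of_length h]⟩
  obtain ⟨l, hl, hle⟩ := exists_length_le_rank T.toList hQ hpos hmono
  have h1 := hle.trans (hρ l (by simp only [A, hl]; exact List.Sublist.refl _))
  rw [Finset.length_toList] at h1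
  have h2 := hT.trans h1
  have ht : 1 ≤ t := (Nat.zero_le _).trans_lt (c ∅).isLt
  obtain ⟨p, rfl⟩ := Nat.exists_eq_add_of_le' hp.one_le
  obtain ⟨k, rfl⟩ := Nat.exists_eq_add_of_le' hk
  obtain ⟨t, rfl⟩ := Nat.exists_eq_add_of_le' ht
  simp only [Nat.add_sub_cancel] at h2
  nlinarith

theorem hasMonochromaticEdge_one : HasMonochromaticEdge 1 := by
  intro k t T c _ hT
  obtain ⟨F, hF, hFk⟩ := Finset.exists_subset_card_eq (show k ≤ #T by simpa using hT)
  exact ⟨fun _ => F, fun _ => ⟨hF, hFk⟩, fun i j hij => absurd (Subsingleton.elim i j) hij,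
    c F, fun _ => rfl⟩

theorem HasMonochromaticEdge.mul {r s : ℕ} (hr : 1 ≤ r) (hs : 1 ≤ s)
    (h₁ : HasMonochromaticEdge r) (h₂ : HasMonochromaticEdge s) :
    HasMonochromaticEdge (r * s) := by
  intro k t T c hk hT
  have ht : 1 ≤ t := (Nat.zero_le _).trans_lt (c ∅).isLt
  have hex : ∀ U : Finset ℕ, ∃ b, (t - 1) * (r - 1) + r * k ≤ #U →
      ∃ f : Fin r → Finset ℕ, (∀ i, f i ⊆ U ∧ #(f i) = k) ∧
        (∀ i j, i ≠ j → Disjoint (f i) (f j)) ∧ ∀ i, c (f i) = b := by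
    intro U
    by_cases hU : (t - 1) * (r - 1) + r * k ≤ #U
    · obtain ⟨f, hf, hd, b, hb⟩ := h₁ k t U c hk hU
      exact ⟨b, fun _ => ⟨f, hf, hd, hb⟩⟩
    · exact ⟨c ∅, fun h => absurd h hU⟩
  choose c' hc' using hex
  obtain ⟨F, hF, hFd, b, hb⟩ := h₂ ((t - 1) * (r - 1) + r * k) t T c'
    (by have := Nat.mul_le_mul hr hk; omega) (by
      refine le_trans (le_of_eq ?_) hT
      obtain ⟨r, rfl⟩ := Nat.exists_eq_add_of_le' hr
      obtain ⟨s, rfl⟩ := Nat.exists_eq_add_of_le' hs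
      have : (r + 1) * (s + 1) - 1 = r * s + r + s := by
        rw [show (r + 1) * (s + 1) = r * s + r + s + 1 by ring, Nat.add_sub_cancel]
      rw [this]
      simp only [Nat.add_sub_cancel]
      ring)
  choose f hf hfd hfc using fun j => hc' (F j) (hF j).2.ge
  let e : Fin (r * s) ≃ Fin r × Fin s := finProdFinEquiv.symm
  refine ⟨fun i => f (e i).2 (e i).1, fun i => ⟨(hf _ _).1.trans (hF _).1, (hf _ _).2⟩,
    fun i j hij => ?_, b, fun i => by rw [hfc, hb]⟩
  by_cases h : (e i).2 = (e j).2
  · have h' : (e i).1 ≠ (e j).1 := fun h' => hij (e.injective (Prod.ext h' h))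
    dsimp only
    rw [h]
    exact hfd _ _ _ h'
  · exact (hFd _ _ h).mono (hf _ _).1 (hf _ _).1

theorem hasMonochromaticEdge {r : ℕ} (hr : 1 ≤ r) : HasMonochromaticEdge r := by
  induction r using induction_on_primes with
  | zero => omega
  | one => exact hasMonochromaticEdge_one
  | prime_mul p r hp ih =>
    have hr' : 1 ≤ r := Nat.pos_of_ne_zero (by rintro rfl; simp at hr)
    exact (hasMonochromaticEdge_of_prime hp).mul hp.one_le hr' (ih hr')

end KneserHypergraph

/-- (Alon–Frankl–Lovász lower bound) For positive integers `n, k, r, t` with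
`n ≥ (t-1)(r-1) + rk`, the Kneser hypergraph `KG^r([n] choose k)` has no proper
coloring with `t` colors, i.e. its chromatic number exceeds `t`. -/
theorem stmt_11 (n k r t : ℕ) (hn : 1 ≤ n) (hk : 1 ≤ k) (hr : 1 ≤ r) (ht : 1 ≤ t)
    (h : (t - 1) * (r - 1) + r * k ≤ n) :
    ¬ ∃ c : Finset ℕ → Fin t, IsProperColKneser r n k t c := by
  rintro ⟨c, hc⟩
  obtain ⟨f, hf, hd, b, hb⟩ := KneserHypergraph.hasMonochromaticEdge hr k t (Finset.Icc 1 n) c hk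
    (by simpa using h)
  obtain ⟨i, j, hij⟩ := hc f hf hd
  exact hij (by rw [hb, hb])
end
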